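/- arXiv:1910.10237 — 8 statements merged into one kernel-verified Lean document; each statement's English description precedes it below -/
import Mathlib

section
/- Let T > 0, C ≥ 0, let P : ℝ × [0,T] → Matrix (Fin 2) (Fin 2) ℂ satisfy ‖P(x,t)‖ ≤ C for all (x,t), and let ν : ℝ × [0,T] → ℂ² be jointly continuous such that for every (x,t) the partial derivative ∂_t ν(x,t) exists and equals P(x,t) ν(x,t). Then for every t ∈ [0,T], e^{-2Ct} ∫₀^∞ ‖ν(x,0)‖² dx ≤ ∫₀^∞ ‖ν(x,t)‖² dx ≤ e^{2Ct} ∫₀^∞ ‖ν(x,0)‖² dx, as an inequality of integrals with values in [0,∞]. In particular, x ↦ ν(x,t) is square-integrable on [0,∞) if and only if x ↦ ν(x,0) is, and is not identically zero if ν(·,0) is not identically zero. -/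
open Set MeasureTheory
open scoped ENNReal

/-- If `‖f'‖ ≤ C ‖f‖` on `[a, b]`, then `‖f‖` grows at most by the factor `e^{C(b - a)}`. -/
theorem norm_le_exp_mul_norm_left {E : Type*} [NormedAddCommGroup E] [NormedSpace ℝ E]
    {f f' : ℝ → E} {C a b : ℝ} (hab : a ≤ b)
    (hf : ∀ s ∈ Icc a b, HasDerivAt f (f' s) s) (hf' : ∀ s ∈ Icc a b, ‖f' s‖ ≤ C * ‖f s‖) :
    ‖f b‖ ≤ Real.exp (C * (b - a)) * ‖f a‖ := by
  have h := norm_le_gronwallBound_of_norm_deriv_right_le (f := f) (f' := f') (δ := ‖f a‖)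
    (K := C) (ε := 0) (fun s hs => (hf s hs).continuousAt.continuousWithinAt)
    (fun s hs => (hf s (Ico_subset_Icc_self hs)).hasDerivWithinAt) le_rfl
    (fun s hs => by simpa using hf' s (Ico_subset_Icc_self hs)) b (right_mem_Icc.2 hab)
  rwa [gronwallBound_ε0, mul_comm] at h

/-- If `‖f'‖ ≤ C ‖f‖` on `[a, b]`, then `‖f‖` decays at most by the factor `e^{-C(b - a)}`. -/
theorem norm_le_exp_mul_norm_right {E : Type*} [NormedAddCommGroup E] [NormedSpace ℝ E]
    {f f' : ℝ → E} {C a b : ℝ} (hab : a ≤ b)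
    (hf : ∀ s ∈ Icc a b, HasDerivAt f (f' s) s) (hf' : ∀ s ∈ Icc a b, ‖f' s‖ ≤ C * ‖f s‖) :
    ‖f a‖ ≤ Real.exp (C * (b - a)) * ‖f b‖ := by
  have hmem : ∀ s ∈ Icc (-b) (-a), -s ∈ Icc a b := fun s hs =>
    ⟨le_neg_of_le_neg hs.2, neg_le_of_neg_le hs.1⟩
  have h := norm_le_exp_mul_norm_left (f := fun s => f (-s)) (f' := fun s => -f' (-s)) (C := C)
    (neg_le_neg hab)
    (fun s hs => by
      simpa [Function.comp_def] using (hf (-s) (hmem s hs)).scomp s (hasDerivAt_neg s))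
    (fun s hs => by simpa using hf' (-s) (hmem s hs))
  simpa [neg_add_eq_sub] using h

theorem nnnorm_sq_le_exp_mul {E : Type*} [NormedAddCommGroup E] {u v : E} {r : ℝ}
    (h : ‖u‖ ≤ Real.exp r * ‖v‖) :
    (‖u‖₊ : ℝ≥0∞) ^ 2 ≤ ENNReal.ofReal (Real.exp (2 * r)) * (‖v‖₊ : ℝ≥0∞) ^ 2 := by
  have key : ‖u‖ ^ 2 ≤ Real.exp (2 * r) * ‖v‖ ^ 2 := by
    calc ‖u‖ ^ 2 ≤ (Real.exp r * ‖v‖) ^ 2 := by gcongr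
      _ = Real.exp (2 * r) * ‖v‖ ^ 2 := by rw [mul_pow, ← Real.exp_nat_mul]; norm_num
  have := ENNReal.ofReal_le_ofReal key
  rwa [ENNReal.ofReal_mul (Real.exp_pos _).le, ENNReal.ofReal_pow (norm_nonneg _),
    ENNReal.ofReal_pow (norm_nonneg _), ofReal_norm, ofReal_norm] at this

theorem setLIntegral_nnnorm_sq_le_exp_mul {α E : Type*} [MeasurableSpace α] {μ : Measure α}
    [NormedAddCommGroup E] {s : Set α} {u v : α → E} {r : ℝ}
    (h : ∀ x, ‖u x‖ ≤ Real.exp r * ‖v x‖) :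
    ∫⁻ x in s, (‖u x‖₊ : ℝ≥0∞) ^ 2 ∂μ ≤
      ENNReal.ofReal (Real.exp (2 * r)) * ∫⁻ x in s, (‖v x‖₊ : ℝ≥0∞) ^ 2 ∂μ := by
  rw [← lintegral_const_mul' _ _ ENNReal.ofReal_ne_top]
  exact lintegral_mono fun x => nnnorm_sq_le_exp_mul (h x)

/-- If `∂_t ν(x,t) = P(x,t) ν(x,t)` with `‖P(x,t)‖ ≤ C`, then the squared `L²` "mass"
of `ν(·,t)` on `[0,∞)` is comparable to that of `ν(·,0)`, with factors `e^{±2Ct}`;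
in particular square integrability on the halfline and nontriviality are preserved. -/
theorem halfline_mass_comparison (T C : ℝ) (hT : 0 < T) (hC : 0 ≤ C)
    (P : ℝ → ℝ → Matrix (Fin 2) (Fin 2) ℂ)
    (hP : ∀ x : ℝ, ∀ t ∈ Icc (0:ℝ) T, ‖Matrix.toEuclideanCLM (𝕜 := ℂ) (P x t)‖ ≤ C)
    (ν : ℝ → ℝ → EuclideanSpace ℂ (Fin 2))
    (hcont : Continuous fun p : ℝ × ℝ => ν p.1 p.2)
    (hν : ∀ x : ℝ, ∀ t ∈ Icc (0:ℝ) T,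
      HasDerivAt (fun s => ν x s) (Matrix.toEuclideanCLM (𝕜 := ℂ) (P x t) (ν x t)) t) :
    ∀ t ∈ Icc (0:ℝ) T,
      (ENNReal.ofReal (Real.exp (-2 * C * t)) * ∫⁻ x in Ici (0:ℝ), (‖ν x 0‖₊ : ℝ≥0∞) ^ 2
          ≤ ∫⁻ x in Ici (0:ℝ), (‖ν x t‖₊ : ℝ≥0∞) ^ 2) ∧
      ((∫⁻ x in Ici (0:ℝ), (‖ν x t‖₊ : ℝ≥0∞) ^ 2)
          ≤ ENNReal.ofReal (Real.exp (2 * C * t)) * ∫⁻ x in Ici (0:ℝ), (‖ν x 0‖₊ : ℝ≥0∞) ^ 2) ∧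
      ((∫⁻ x in Ici (0:ℝ), (‖ν x t‖₊ : ℝ≥0∞) ^ 2) < ⊤ ↔
        (∫⁻ x in Ici (0:ℝ), (‖ν x 0‖₊ : ℝ≥0∞) ^ 2) < ⊤) ∧
      ((∃ x ≥ (0:ℝ), ν x 0 ≠ 0) → ∃ x ≥ (0:ℝ), ν x t ≠ 0) := by
  intro t ht
  have hsub : Icc 0 t ⊆ Icc 0 T := Icc_subset_Icc_right ht.2
  have hbd : ∀ x, ∀ s ∈ Icc 0 t,
      ‖Matrix.toEuclideanCLM (𝕜 := ℂ) (P x s) (ν x s)‖ ≤ C * ‖ν x s‖ := fun x s hs =>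
    ContinuousLinearMap.le_of_opNorm_le _ (hP x s (hsub hs)) _
  have hfwd : ∀ x, ‖ν x t‖ ≤ Real.exp (C * t) * ‖ν x 0‖ := fun x => by
    simpa using norm_le_exp_mul_norm_left ht.1 (fun s hs => hν x s (hsub hs)) (hbd x)
  have hbwd : ∀ x, ‖ν x 0‖ ≤ Real.exp (C * t) * ‖ν x t‖ := fun x => by
    simpa using norm_le_exp_mul_norm_right ht.1 (fun s hs => hν x s (hsub hs)) (hbd x)
  have hupper := setLIntegral_nnnorm_sq_le_exp_mul (μ := volume) (s := Ici (0:ℝ)) hfwd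
  have hlower := setLIntegral_nnnorm_sq_le_exp_mul (μ := volume) (s := Ici (0:ℝ)) hbwd
  rw [← mul_assoc] at hupper hlower
  refine ⟨?_, hupper,
    ⟨fun h => hlower.trans_lt (ENNReal.mul_lt_top ENNReal.ofReal_lt_top h),
      fun h => hupper.trans_lt (ENNReal.mul_lt_top ENNReal.ofReal_lt_top h)⟩, ?_⟩
  · refine (mul_le_mul_right hlower _).trans_eq ?_
    rw [← mul_assoc, ← ENNReal.ofReal_mul (Real.exp_pos _).le, ← Real.exp_add]
    simp
  · rintro ⟨x, hx, h0⟩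
    refine ⟨x, hx, fun hxt => h0 ?_⟩
    simpa [hxt] using hbwd x
end

section
/- Let E̲ ∈ ℝ, let J be a countable index set, for each j ∈ J let E_j^- < E_j^+ be real numbers with E̲ ≤ E_j^-, with the open intervals (E_j^-, E_j^+) pairwise disjoint, and suppose Σ_{j∈J} γ_j (1 + η_{j,0}^n) < ∞ for a fixed positive integer n. Then for every integer k with 1 ≤ k ≤ n+1, the series Σ_{j∈J} ((E_j^-)^k + (E_j^+)^k − 2 μ_j(φ)^k) converges absolutely for every φ ∈ 𝒟 = (ℝ/2πℤ)^J, and the function Q_k : 𝒟 → ℝ, Q_k(φ) = E̲^k + Σ_{j∈J} ((E_j^-)^k + (E_j^+)^k − 2 μ_j(φ)^k), is continuous with respect to the product topology on 𝒟. -/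
open scoped BigOperators

/-- The Dirichlet eigenvalue `μ_j(φ) = E_j^- + γ_j cos²(φ_j/2)`, written using
`cos²(θ/2) = (1 + cos θ)/2` so that it is well defined on the torus `(ℝ/2πℤ)^J`. -/
noncomputable def gapMu {J : Type*} (Em Ep : J → ℝ) (φ : J → Real.Angle) (j : J) : ℝ :=
  Em j + (Ep j - Em j) * (1 + (φ j).cos) / 2

theorem abs_pow_sub_pow_le_of_abs_le {x y R : ℝ} (k : ℕ) (hx : |x| ≤ R) (hy : |y| ≤ R) :
    |x ^ k - y ^ k| ≤ |x - y| * k * R ^ (k - 1) := by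
  refine (abs_pow_sub_pow_le x y k).trans ?_
  have h : max |x| |y| ≤ R := max_le hx hy
  have h0 : 0 ≤ max |x| |y| := (abs_nonneg x).trans (le_max_left _ _)
  gcongr

theorem add_pow_le_mul_one_add_pow {C η : ℝ} (hC : 0 ≤ C) (hη : 0 ≤ η) {m n : ℕ} (hmn : m ≤ n) :
    (C + η) ^ m ≤ (1 + C) ^ n * 2 ^ (n - 1) * (1 + η ^ n) := by
  calc (C + η) ^ m ≤ ((1 + C) * (1 + η)) ^ m := by
        gcongr
        nlinarith [mul_nonneg hC hη]
    _ ≤ ((1 + C) * (1 + η)) ^ n := by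
        refine pow_le_pow_right₀ ?_ hmn
        nlinarith [mul_nonneg hC hη]
    _ = (1 + C) ^ n * (1 + η) ^ n := mul_pow _ _ _
    _ ≤ (1 + C) ^ n * (2 ^ (n - 1) * (1 ^ n + η ^ n)) := by
        gcongr
        exact add_pow_le zero_le_one hη n
    _ = (1 + C) ^ n * 2 ^ (n - 1) * (1 + η ^ n) := by
        rw [one_pow, mul_assoc]

theorem gapMu_mem_Icc {J : Type*} {Em Ep : J → ℝ} {j : J} (h : Em j ≤ Ep j)
    (φ : J → Real.Angle) : gapMu Em Ep φ j ∈ Set.Icc (Em j) (Ep j) := by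
  have hc : |(φ j).cos| ≤ 1 := by
    induction φ j using Real.Angle.induction_on with
    | h x => exact Real.abs_cos_le_one x
  obtain ⟨h1, h2⟩ := abs_le.mp hc
  unfold gapMu
  constructor <;> nlinarith

theorem continuous_gapMu {J : Type*} (Em Ep : J → ℝ) (j : J) :
    Continuous fun φ : J → Real.Angle => gapMu Em Ep φ j := by
  unfold gapMu
  have : Continuous fun φ : J → Real.Angle => (φ j).cos :=
    Real.Angle.continuous_cos.comp (continuous_apply j)
  fun_prop

/-- Points of a gap of length at most `S` contribute terms bounded by the moment of the gap. -/
theorem abs_gap_term_le {a b x E S : ℝ} (hx : x ∈ Set.Icc a b) (hE : E ≤ a) (hS : b - a ≤ S)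
    {k n : ℕ} (hk : k ≤ n + 1) :
    |a ^ k + b ^ k - 2 * x ^ k| ≤
      2 * k * ((1 + (|E| + S)) ^ n * 2 ^ (n - 1)) * ((b - a) * (1 + (a - E) ^ n)) := by
  obtain ⟨hax, hxb⟩ := hx
  have hE1 := neg_abs_le E
  have hE2 := le_abs_self E
  have hE0 := abs_nonneg E
  have bound : ∀ y, a ≤ y → y ≤ b → |y| ≤ |E| + S + (a - E) := fun y h1 h2 =>
    abs_le.mpr ⟨by linarith, by linarith⟩
  have diff : ∀ y, a ≤ y → y ≤ b →
      |y ^ k - x ^ k| ≤ (b - a) * k * (|E| + S + (a - E)) ^ (k - 1) := fun y h1 h2 => by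
    refine (abs_pow_sub_pow_le_of_abs_le k (bound y h1 h2) (bound x hax hxb)).trans ?_
    have h3 : |y - x| ≤ b - a := abs_le.mpr ⟨by linarith, by linarith⟩
    have h4 : 0 ≤ |E| + S + (a - E) := by linarith
    gcongr
  have hpow : (|E| + S + (a - E)) ^ (k - 1) ≤
      (1 + (|E| + S)) ^ n * 2 ^ (n - 1) * (1 + (a - E) ^ n) :=
    add_pow_le_mul_one_add_pow (by linarith) (by linarith) (by omega)
  have hba : 0 ≤ b - a := by linarith
  calc |a ^ k + b ^ k - 2 * x ^ k| = |(a ^ k - x ^ k) + (b ^ k - x ^ k)| := by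
        congr 1; ring
    _ ≤ |a ^ k - x ^ k| + |b ^ k - x ^ k| := abs_add_le _ _
    _ ≤ 2 * ((b - a) * k * (|E| + S + (a - E)) ^ (k - 1)) := by
        linarith [diff a le_rfl (hax.trans hxb), diff b (hax.trans hxb) le_rfl]
    _ ≤ 2 * ((b - a) * k * ((1 + (|E| + S)) ^ n * 2 ^ (n - 1) * (1 + (a - E) ^ n))) := by
        gcongr
    _ = _ := by ring

/-- Under the moment condition `Σ γ_j (1 + η_{j,0}^n) < ∞`, for `1 ≤ k ≤ n+1` the series
defining `Q_k` converges absolutely and `Q_k` is continuous on the torus of Dirichlet data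
with the product topology. -/
theorem Qk_continuous {J : Type*} [Countable J] (Ebot : ℝ) (Em Ep : J → ℝ)
    (hlt : ∀ j, Em j < Ep j) (hbot : ∀ j, Ebot ≤ Em j)
    (hdisj : ∀ i j, i ≠ j → Disjoint (Set.Ioo (Em i) (Ep i)) (Set.Ioo (Em j) (Ep j)))
    (n : ℕ) (hn : 1 ≤ n)
    (hmom : Summable fun j => (Ep j - Em j) * (1 + (Em j - Ebot) ^ n)) :
    ∀ k : ℕ, 1 ≤ k → k ≤ n + 1 →
      (∀ φ : J → Real.Angle,
        Summable fun j => |Em j ^ k + Ep j ^ k - 2 * gapMu Em Ep φ j ^ k|) ∧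
      Continuous fun φ : J → Real.Angle =>
        Ebot ^ k + ∑' j, (Em j ^ k + Ep j ^ k - 2 * gapMu Em Ep φ j ^ k) := by
  intro k _ hk
  have hγ : ∀ j, 0 ≤ Ep j - Em j := fun j => (sub_pos.mpr (hlt j)).le
  have hη : ∀ j, 0 ≤ Em j - Ebot := fun j => sub_nonneg.mpr (hbot j)
  have hsum : Summable fun j => Ep j - Em j :=
    hmom.of_nonneg_of_le hγ fun j =>
      le_mul_of_one_le_right (hγ j) (le_add_of_nonneg_right (pow_nonneg (hη j) n))
  have hbound : ∀ j (φ : J → Real.Angle), |Em j ^ k + Ep j ^ k - 2 * gapMu Em Ep φ j ^ k| ≤ _ :=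
    fun j φ => abs_gap_term_le (gapMu_mem_Icc (hlt j).le φ) (hbot j)
      (hsum.le_tsum j fun i _ => hγ i) hk
  have hmaj := hmom.mul_left
    (2 * k * ((1 + (|Ebot| + ∑' j, (Ep j - Em j))) ^ n * 2 ^ (n - 1)) : ℝ)
  refine ⟨fun φ => hmaj.of_nonneg_of_le (fun _ => abs_nonneg _) fun j => hbound j φ, ?_⟩
  exact continuous_const.add <| continuous_tsum
    (fun j => continuous_const.sub (continuous_const.mul ((continuous_gapMu Em Ep j).pow k)))
    hmaj hbound
end

section
/- Let E̲ ∈ ℝ, let J be a countable index set with gaps (E_j^-, E_j^+), j ∈ J, pairwise disjoint, E̲ ≤ E_j^-. Fix j ∈ J and suppose η_{j,ℓ} > 0 for all ℓ ≠ j and Σ_{ℓ≠j} γ_ℓ/η_{j,ℓ} < ∞ (so that C_j < ∞). Then for every family (μ_ℓ)_{ℓ∈J} with μ_ℓ ∈ [E_ℓ^-, E_ℓ^+] for all ℓ, the infinite product ∏_{ℓ≠j} ((E_ℓ^- − μ_j)(E_ℓ^+ − μ_j))/(μ_ℓ − μ_j)² converges to a value in (0, ∞), and Ψ_j := 2 √(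 (μ_j − E̲) ∏_{ℓ≠j} ((E_ℓ^- − μ_j)(E_ℓ^+ − μ_j))/(μ_ℓ − μ_j)² ) satisfies 0 ≤ Ψ_j ≤ 2 C_j. -/
open scoped BigOperators

/-- For `0 < a`, `a ≤ m ≤ b` and `b - a ≤ t * a`, the quotient `a * b / m ^ 2` is positive and
both it and its inverse are at most `1 + t`. -/
lemma mul_div_sq_bounds {a b m t : ℝ} (ha : 0 < a) (ham : a ≤ m) (hmb : m ≤ b)
    (ht : b ≤ (1 + t) * a) :
    0 < a * b / m ^ 2 ∧ a * b / m ^ 2 ≤ 1 + t ∧ (a * b / m ^ 2)⁻¹ ≤ 1 + t := by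
  have hm : 0 < m := ha.trans_le ham
  have hb : 0 < b := hm.trans_le hmb
  have ht0 : 0 ≤ 1 + t := nonneg_of_mul_nonneg_left (hb.le.trans ht) ha
  refine ⟨by positivity, ?_, ?_⟩
  · rw [div_le_iff₀ (by positivity)]
    calc a * b ≤ a * ((1 + t) * a) := by gcongr
      _ = (1 + t) * a ^ 2 := by ring
      _ ≤ (1 + t) * m ^ 2 := by gcongr
  · rw [inv_div, div_le_iff₀ (by positivity)]
    calc m ^ 2 ≤ b ^ 2 := by gcongr
      _ = b * b := by ring
      _ ≤ ((1 + t) * a) * b := by gcongr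
      _ = (1 + t) * (a * b) := by ring

/-- The bounds on a factor of the Dubrovin product: for `x` in one gap and `m` in another gap
`[p, q]` at distance `d > 0`. -/
lemma gap_factor_bounds {p q m x u v d : ℝ} (hd : 0 < d)
    (hdist : (v ≤ p ∧ d = p - v) ∨ (q ≤ u ∧ d = u - q))
    (hm : m ∈ Set.Icc p q) (hx : x ∈ Set.Icc u v) :
    0 < (p - x) * (q - x) / (m - x) ^ 2 ∧
      (p - x) * (q - x) / (m - x) ^ 2 ≤ 1 + (q - p) / d ∧
      ((p - x) * (q - x) / (m - x) ^ 2)⁻¹ ≤ 1 + (q - p) / d := by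
  obtain ⟨hpm, hmq⟩ := hm
  obtain ⟨hux, hxv⟩ := hx
  have hpq : 0 ≤ (q - p) / d := div_nonneg (by linarith) hd.le
  have hcancel : (q - p) / d * d = q - p := div_mul_cancel₀ _ hd.ne'
  rcases hdist with ⟨-, h⟩ | ⟨-, h⟩
  · have := mul_le_mul_of_nonneg_left (show d ≤ p - x by linarith) hpq
    exact mul_div_sq_bounds (by linarith) (by linarith) (by linarith) (by linarith)
  · have := mul_le_mul_of_nonneg_left (show d ≤ x - q by linarith) hpq
    have key := mul_div_sq_bounds (a := x - q) (b := x - p) (m := x - m) (t := (q - p) / d)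
      (by linarith) (by linarith) (by linarith) (by linarith)
    rwa [show (x - q) * (x - p) = (p - x) * (q - x) by ring,
      show (x - m) ^ 2 = (m - x) ^ 2 by ring] at key

/-- A positive family that lies, together with its inverse, below `1 + t` with `t` summable
has summable logarithms. -/
lemma summable_log_of_le_one_add {ι : Type*} {f t : ι → ℝ} (ht : Summable t)
    (hpos : ∀ i, 0 < f i) (hle : ∀ i, f i ≤ 1 + t i) (hinv : ∀ i, (f i)⁻¹ ≤ 1 + t i) :
    Summable fun i => Real.log (f i) := by
  refine ht.of_norm_bounded fun i => ?_
  have h1 := Real.log_le_sub_one_of_pos (hpos i)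
  have h2 := Real.log_le_sub_one_of_pos (inv_pos.2 (hpos i))
  rw [Real.log_inv] at h2
  rw [Real.norm_eq_abs, abs_le]
  constructor <;> linarith [hle i, hinv i]

lemma sqrt_tprod_le_tprod_sqrt {ι : Type*} {f g : ι → ℝ} (hf : ∀ i, 0 < f i)
    (hfg : ∀ i, f i ≤ g i) (hlf : Summable fun i => Real.log (f i))
    (hlg : Summable fun i => Real.log (g i)) :
    Real.sqrt (∏' i, f i) ≤ ∏' i, Real.sqrt (g i) := by
  have hg : ∀ i, 0 < g i := fun i => (hf i).trans_le (hfg i)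
  have hlog : (fun i => Real.log (Real.sqrt (g i))) = fun i => Real.log (g i) / 2 :=
    funext fun i => Real.log_sqrt (hg i).le
  rw [← Real.rexp_tsum_eq_tprod hf hlf,
    ← Real.rexp_tsum_eq_tprod (fun i => Real.sqrt_pos.2 (hg i))
      (by rw [hlog]; exact hlg.div_const 2), hlog, tsum_div_const, ← Real.exp_half]
  gcongr with i
  exacts [hf i, hfg i]

/-- The infinite product in the Dubrovin vector field converges to a positive number and
`0 ≤ Ψ_j ≤ 2 C_j`, where
`C_j = (η_{j,0} + γ_j)^{1/2} Π_{ℓ≠j} (1 + γ_ℓ/η_{j,ℓ})^{1/2}`. -/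
theorem Psi_bound {J : Type*} [Countable J] (Ebot : ℝ) (Em Ep : J → ℝ)
    (hlt : ∀ l, Em l < Ep l) (hbot : ∀ l, Ebot ≤ Em l)
    (j : J) (η : J → ℝ)
    (hηpos : ∀ l, l ≠ j → 0 < η l)
    (hηdist : ∀ l, l ≠ j →
      (Ep j ≤ Em l ∧ η l = Em l - Ep j) ∨ (Ep l ≤ Em j ∧ η l = Em j - Ep l))
    (hsum : Summable fun l : {l : J // l ≠ j} => (Ep l.1 - Em l.1) / η l.1)
    (μ : J → ℝ) (hμ : ∀ l, μ l ∈ Set.Icc (Em l) (Ep l)) :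
    Multipliable (fun l : {l : J // l ≠ j} =>
      ((Em l.1 - μ j) * (Ep l.1 - μ j)) / (μ l.1 - μ j) ^ 2) ∧
    0 < (∏' l : {l : J // l ≠ j},
      ((Em l.1 - μ j) * (Ep l.1 - μ j)) / (μ l.1 - μ j) ^ 2) ∧
    0 ≤ 2 * Real.sqrt ((μ j - Ebot) *
      ∏' l : {l : J // l ≠ j}, ((Em l.1 - μ j) * (Ep l.1 - μ j)) / (μ l.1 - μ j) ^ 2) ∧
    2 * Real.sqrt ((μ j - Ebot) *
      ∏' l : {l : J // l ≠ j}, ((Em l.1 - μ j) * (Ep l.1 - μ j)) / (μ l.1 - μ j) ^ 2)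
      ≤ 2 * (Real.sqrt ((Em j - Ebot) + (Ep j - Em j)) *
        ∏' l : {l : J // l ≠ j}, Real.sqrt (1 + (Ep l.1 - Em l.1) / η l.1)) := by
  have hb := fun l : {l : J // l ≠ j} =>
    gap_factor_bounds (hηpos l.1 l.2) (hηdist l.1 l.2) (hμ l.1) (hμ j)
  have hlog := summable_log_of_le_one_add hsum (fun l => (hb l).1) (fun l => (hb l).2.1)
    (fun l => (hb l).2.2)
  have hlog' := Real.summable_log_one_add_of_summable hsum
  have hbot_le : 0 ≤ μ j - Ebot := by linarith [hbot j, (hμ j).1]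
  refine ⟨Real.multipliable_of_summable_log (fun l => (hb l).1) hlog, ?_, by positivity, ?_⟩
  · rw [← Real.rexp_tsum_eq_tprod (fun l => (hb l).1) hlog]
    exact Real.exp_pos _
  · rw [Real.sqrt_mul hbot_le]
    gcongr
    · linarith [(hμ j).2]
    · exact sqrt_tprod_le_tprod_sqrt (fun l => (hb l).1) (fun l => (hb l).2.1) hlog hlog'
end

section
/- Let E̲ ∈ ℝ, let J be a countable index set with gaps (E_j^-, E_j^+), j ∈ J, pairwise disjoint, E̲ ≤ E_j^-. Fix j, k ∈ J with k ≠ j, suppose η_{j,ℓ} > 0 for all ℓ ≠ j and Σ_{ℓ≠j} γ_ℓ/η_{j,ℓ} < ∞. Fix μ_ℓ ∈ [E_ℓ^-, E_ℓ^+] for all ℓ ≠ k, and for t ∈ ℝ/2πℤ set μ_k(t) = E_k^- + γ_k cos²(t/2). Then the function t ↦ Ψ_j(t) := 2 √( (μ_j − E̲) ∏_{ℓ≠j} ((E_ℓ^- − μ_j)(E_ℓ^+ − μ_j))/(μ_ℓ − μ_j)² ) (with μ_k = μ_k(t) in the factor ℓ = k) is differentiable and satisfies |dΨ_j/dt| ≤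 C_j γ_k / η_{j,k}. -/
/-- Termwise comparison of unconditionally convergent products of nonnegative reals. -/
theorem HasProd.le_of_nonneg {ι : Type*} {f g : ι → ℝ} {a b : ℝ} (hf : HasProd f a)
    (hg : HasProd g b) (h0 : ∀ i, 0 ≤ f i) (h : ∀ i, f i ≤ g i) : a ≤ b :=
  le_of_tendsto_of_tendsto' hf hg fun _ => Finset.prod_le_prod (fun i _ => h0 i) fun i _ => h i

/-- An unconditional infinite product of nonnegative reals is nonnegative. -/
theorem tprod_nonneg_of_nonneg {ι : Type*} {f : ι → ℝ} (h0 : ∀ i, 0 ≤ f i) : 0 ≤ ∏' i, f i := by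
  by_cases hf : Multipliable f
  · exact ge_of_tendsto' hf.hasProd fun s => Finset.prod_nonneg fun i _ => h0 i
  · simp [tprod_eq_one_of_not_multipliable hf]

/-- If `m` lies between `A` and `A + g`, where `A ≥ e > 0`, then `A (A + g) / m²` lies between
`1 - g / e` and `1 + g / e`. -/
theorem mul_div_sq_bounds_s12 {A g m e : ℝ} (he : 0 < e) (hA : e ≤ A) (hg : 0 < g)
    (h1 : A ≤ m) (h2 : m ≤ A + g) :
    0 ≤ A * (A + g) / m ^ 2 ∧ A * (A + g) / m ^ 2 ≤ 1 + g / e ∧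
      1 - g / e ≤ A * (A + g) / m ^ 2 := by
  have hA0 : 0 < A := he.trans_le hA
  have hm : 0 < m := hA0.trans_le h1
  have hge : g / A ≤ g / e := by gcongr
  have hAg : A * (A + g) = A ^ 2 * (1 + g / A) := by field_simp
  have hlow : A * (A + g) = (A + g) ^ 2 * (1 - g / (A + g)) := by field_simp; ring
  refine ⟨by positivity, ?_, ?_⟩
  · rw [div_le_iff₀ (by positivity), hAg]
    have : A ^ 2 ≤ m ^ 2 := by gcongr
    have : 0 < g / A := by positivity
    nlinarith [sq_nonneg m]
  · have hge' : g / (A + g) ≤ g / e := by gcongr; linarith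
    have hle : g / (A + g) ≤ 1 := by rw [div_le_one (by positivity)]; linarith
    rw [le_div_iff₀ (by positivity), hlow]
    have : m ^ 2 ≤ (A + g) ^ 2 := by gcongr
    nlinarith [sq_nonneg m]

/-- The factor attached to a gap `[a, b]` at distance `e` from the gap `[p, q]`, for a point `x` of
`[p, q]` and a point `y` of `[a, b]`. -/
theorem gap_factor_bounds_s12 {a b p q x y e : ℝ} (hab : a < b) (he : 0 < e)
    (hd : (q ≤ a ∧ e = a - q) ∨ (b ≤ p ∧ e = p - b)) (hx : x ∈ Set.Icc p q)
    (hy : y ∈ Set.Icc a b) :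
    0 ≤ (a - x) * (b - x) / (y - x) ^ 2 ∧
      (a - x) * (b - x) / (y - x) ^ 2 ≤ 1 + (b - a) / e ∧
      1 - (b - a) / e ≤ (a - x) * (b - x) / (y - x) ^ 2 := by
  obtain ⟨hx1, hx2⟩ := hx
  obtain ⟨hy1, hy2⟩ := hy
  rcases hd with ⟨_, h⟩ | ⟨_, h⟩
  · have := mul_div_sq_bounds_s12 (A := a - x) (g := b - a) (m := y - x) he (by linarith)
      (by linarith) (by linarith) (by linarith)
    rwa [show a - x + (b - a) = b - x by ring] at this
  · have := mul_div_sq_bounds_s12 (A := x - b) (g := b - a) (m := x - y) he (by linarith)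
      (by linarith) (by linarith) (by linarith)
    rwa [show x - b + (b - a) = x - a by ring,
      show (x - b) * (x - a) = (a - x) * (b - x) by ring,
      show (x - y) ^ 2 = (y - x) ^ 2 by ring] at this

/-- Square roots of `1 + u i` with `u` nonnegative and summable have a convergent product, whose
square is the product of the `1 + u i`. -/
theorem hasProd_one_add_sq_tprod_sqrt {ι : Type*} {u : ι → ℝ} (hu0 : ∀ i, 0 ≤ u i)
    (hu : Summable u) :
    HasProd (fun i => 1 + u i) ((∏' i, √(1 + u i)) ^ 2) := by
  have hm : Multipliable fun i => √(1 + u i) := by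
    have hs : Summable fun i => ‖√(1 + u i) - 1‖ := by
      refine hu.of_nonneg_of_le (fun i => norm_nonneg _) fun i => ?_
      have h1 : 1 ≤ √(1 + u i) := Real.one_le_sqrt.2 (by linarith [hu0 i])
      have h2 : √(1 + u i) ^ 2 = 1 + u i := Real.sq_sqrt (by linarith [hu0 i])
      rw [Real.norm_of_nonneg (by linarith)]
      nlinarith
    simpa using multipliable_one_add_of_summable hs
  have h := hm.hasProd.mul hm.hasProd
  rw [← sq] at h
  refine h.congr_fun ?_
  intro i
  exact (Real.mul_self_sqrt (by linarith [hu0 i])).symm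

/-- Off-diagonal derivative bound for the Dubrovin vector field: varying only the `k`-th
Dirichlet eigenvalue `μ_k(t) = E_k^- + γ_k cos²(t/2)` (`k ≠ j`), the component `Ψ_j` is
differentiable in `t` with `|dΨ_j/dt| ≤ C_j γ_k / η_{j,k}`. -/
theorem Psi_offdiagonal_derivative_bound {J : Type*} [Countable J] [DecidableEq J]
    (Ebot : ℝ) (Em Ep : J → ℝ)
    (hlt : ∀ l, Em l < Ep l) (hbot : ∀ l, Ebot ≤ Em l)
    (j k : J) (hkj : k ≠ j) (η : J → ℝ)
    (hηpos : ∀ l, l ≠ j → 0 < η l)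
    (hηdist : ∀ l, l ≠ j →
      (Ep j ≤ Em l ∧ η l = Em l - Ep j) ∨ (Ep l ≤ Em j ∧ η l = Em j - Ep l))
    (hsum : Summable fun l : {l : J // l ≠ j} => (Ep l.1 - Em l.1) / η l.1)
    (μ : J → ℝ) (hμ : ∀ l, μ l ∈ Set.Icc (Em l) (Ep l))
    (C : ℝ)
    (hC : C = Real.sqrt ((Em j - Ebot) + (Ep j - Em j)) *
      ∏' l : {l : J // l ≠ j}, Real.sqrt (1 + (Ep l.1 - Em l.1) / η l.1)) :
    ∀ t : ℝ, ∃ d : ℝ,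
      HasDerivAt (fun s : ℝ =>
        2 * Real.sqrt ((μ j - Ebot) *
          ∏' l : {l : J // l ≠ j},
            ((Em l.1 - μ j) * (Ep l.1 - μ j)) /
              (Function.update μ k (Em k + (Ep k - Em k) * Real.cos (s / 2) ^ 2) l.1
                - μ j) ^ 2)) d t ∧
      |d| ≤ C * (Ep k - Em k) / η k := by
  intro t
  set u : {l : J // l ≠ j} → ℝ := fun l => (Ep l.1 - Em l.1) / η l.1
  have hu0 : ∀ l, 0 ≤ u l := fun l =>
    div_nonneg (by linarith [hlt l.1]) (hηpos l.1 l.2).le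
  set P := ∏' l : {l : J // l ≠ j}, √(1 + u l)
  have hPprod : HasProd (fun l => 1 + u l) (P ^ 2) := hasProd_one_add_sq_tprod_sqrt hu0 hsum
  set y : ℝ → ℝ := fun s => Em k + (Ep k - Em k) * Real.cos (s / 2) ^ 2 with hy
  have hyIcc : ∀ s, y s ∈ Set.Icc (Em k) (Ep k) := fun s => by
    have h1 := Real.cos_sq_le_one (s / 2)
    have h2 := sq_nonneg (Real.cos (s / 2))
    constructor <;> simp only [hy] <;> nlinarith [hlt k]
  set f : ℝ → {l : J // l ≠ j} → ℝ := fun s l =>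
    ((Em l.1 - μ j) * (Ep l.1 - μ j)) / (Function.update μ k (y s) l.1 - μ j) ^ 2 with hf
  have hνIcc : ∀ l, Function.update μ k (y t) l ∈ Set.Icc (Em l) (Ep l) := fun l => by
    rcases eq_or_ne l k with rfl | h
    · simpa using hyIcc t
    · simpa [h] using hμ l
  have hfb : ∀ l, 0 ≤ f t l ∧ f t l ≤ 1 + u l ∧ 1 - u l ≤ f t l := fun l =>
    gap_factor_bounds_s12 (hlt l.1) (hηpos l.1 l.2) (hηdist l.1 l.2) (hμ j) (hνIcc l.1)
  have hfm : Multipliable (f t) := by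
    have hs : Summable fun l => ‖f t l - 1‖ :=
      hsum.of_nonneg_of_le (fun l => norm_nonneg _) fun l => by
        obtain ⟨-, h1, h2⟩ := hfb l
        exact abs_le.2 ⟨by linarith, by linarith⟩
    simpa using multipliable_one_add_of_summable hs
  set T := ∏' l, f t l
  have hTle : T ≤ P ^ 2 := hfm.hasProd.le_of_nonneg hPprod (fun l => (hfb l).1) fun l => (hfb l).2.1
  have hP0 : 0 ≤ P := tprod_nonneg_of_nonneg fun l => Real.sqrt_nonneg _
  set m : ℝ → ℝ := fun s => y s - μ j with hm
  have hηm : ∀ s, η k ≤ |m s| := fun s => by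
    obtain ⟨h1, h2⟩ := hyIcc s
    obtain ⟨h3, h4⟩ := hμ j
    rcases hηdist k hkj with ⟨_, h⟩ | ⟨_, h⟩
    · exact le_abs.2 (Or.inl (by simp only [hm]; linarith))
    · exact le_abs.2 (Or.inr (by simp only [hm]; linarith))
  have hη := hηpos k hkj
  have hm0 : ∀ s, m s ≠ 0 := fun s => abs_pos.1 (hη.trans_le (hηm s))
  have hmt : ∀ s, 0 < m t / m s := fun s => by
    obtain ⟨h1, h2⟩ := hyIcc s
    obtain ⟨h1', h2'⟩ := hyIcc t
    obtain ⟨h3, h4⟩ := hμ j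
    rcases hηdist k hkj with ⟨_, h⟩ | ⟨_, h⟩
    · exact div_pos (by simp only [hm]; linarith) (by simp only [hm]; linarith)
    · exact div_pos_of_neg_of_neg (by simp only [hm]; linarith) (by simp only [hm]; linarith)
  have hprod : ∀ s, ∏' l, f s l = T * (m t / m s) ^ 2 := fun s => by
    refine ((hfm.hasProd.mul
      (hasProd_ite_eq (⟨k, hkj⟩ : {l : J // l ≠ j}) ((m t / m s) ^ 2))).congr_fun ?_).tprod_eq
    rintro ⟨l, hl⟩
    rcases eq_or_ne l k with rfl | h
    · have := hm0 s
      have := hm0 t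
      simp only [hf, Function.update_self, if_true]
      change _ / (m s) ^ 2 = _ / (m t) ^ 2 * _
      field_simp
    · simp [hf, h]
  have ha : 0 ≤ μ j - Ebot := by linarith [hbot j, (hμ j).1]
  have hT0 : 0 ≤ T := tprod_nonneg_of_nonneg fun l => (hfb l).1
  have hfun : (fun s => 2 * √((μ j - Ebot) * ∏' l, f s l)) =
      fun s => 2 * √((μ j - Ebot) * T) * m t * (m s)⁻¹ := by
    funext s
    rw [hprod, ← mul_assoc, Real.sqrt_mul' _ (sq_nonneg _), Real.sqrt_sq (hmt s).le]
    ring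
  have hmd : HasDerivAt m (-((Ep k - Em k) * Real.sin t / 2)) t := by
    have h1 : HasDerivAt (fun s : ℝ => Real.cos (s / 2)) (-Real.sin (t / 2) * (1 / 2)) t :=
      ((hasDerivAt_id t).div_const 2).cos
    have h2 : Real.sin t = 2 * Real.sin (t / 2) * Real.cos (t / 2) := by
      rw [← Real.sin_two_mul]; ring_nf
    refine ((((h1.pow 2).const_mul (Ep k - Em k)).const_add (Em k)).sub_const (μ j)).congr_deriv ?_
    rw [h2]
    push_cast
    ring
  refine ⟨_, hfun ▸ (hmd.fun_inv (hm0 t)).const_mul _, ?_⟩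
  have hΨ : √((μ j - Ebot) * T) ≤ C := by
    rw [hC, ← Real.sqrt_sq hP0, ← Real.sqrt_mul' _ (sq_nonneg _)]
    refine Real.sqrt_le_sqrt (mul_le_mul ?_ hTle hT0 ?_) <;> linarith [(hμ j).2]
  have hg : 0 < Ep k - Em k := by linarith [hlt k]
  have hd : 2 * √((μ j - Ebot) * T) * m t * (-(-((Ep k - Em k) * Real.sin t / 2)) / m t ^ 2) =
      √((μ j - Ebot) * T) * (Ep k - Em k) * (Real.sin t / m t) := by
    have := hm0 t
    field_simp
  have hC0 : 0 ≤ C := (Real.sqrt_nonneg _).trans hΨ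
  rw [hd, abs_mul, abs_of_nonneg (by positivity), abs_div, mul_div_assoc']
  calc √((μ j - Ebot) * T) * (Ep k - Em k) * |Real.sin t| / |m t|
      ≤ C * (Ep k - Em k) * 1 / η k := by
        gcongr
        · exact Real.abs_sin_le_one t
        · exact hηm t
    _ = C * (Ep k - Em k) / η k := by rw [mul_one]
end

section
/- Let E̲ ∈ ℝ, let J be a countable index set with gaps (E_j^-, E_j^+), j ∈ J, pairwise disjoint, E̲ ≤ E_j^-, with η_{j,0} > 0 and η_{j,ℓ} > 0 for all j ≠ ℓ in J, and fix a positive integer n. Assume the Craig-type conditions: (C1) Σ_{k∈J} γ_k^{1/2}(1 + η_{k,0}^n)^{1/2} < ∞; (C2) sup_{j∈J} C_j (1 + η_{j,0}^n)^{3/2} Σ_{k≠j} γ_k^{1/2} γ_j^{1/2} / η_{j,k} < ∞; (C3) sup_{j∈J} γ_j (1 + η_{j,0}^n) C_j / η_{j,0} < ∞; (C4) sup_{j∈J} C_j γ_j^{1/2} (1 + η_{j,0}^n)^{3/2} < ∞. Then the vector field Ξ on 𝒟 = (ℝ/2πℤ)^J with components Ξ_j(φ) = (Σ_{ℓ=0}^n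 R_{n−ℓ}(φ) μ_j(φ)^ℓ) Ψ_j(φ) is Lipschitz with respect to the metric ‖φ − ψ‖ = sup_{j∈J} γ_j^{1/2}(1 + η_{j,0}^n)^{1/2} dist_𝕋(φ_j, ψ_j): there exists L < ∞ such that sup_{j∈J} γ_j^{1/2}(1 + η_{j,0}^n)^{1/2} |Ξ_j(φ) − Ξ_j(ψ)| ≤ L ‖φ − ψ‖ for all φ, ψ ∈ 𝒟. -/
open scoped BigOperators

/-- The scalar field `Q_k(φ) = E̲^k + Σ_j ((E_j^-)^k + (E_j^+)^k − 2 μ_j(φ)^k)`. -/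
noncomputable def Qfield {J : Type*} (Ebot : ℝ) (Em Ep : J → ℝ) (k : ℕ)
    (φ : J → Real.Angle) : ℝ :=
  Ebot ^ k + ∑' j, (Em j ^ k + Ep j ^ k - 2 * gapMu Em Ep φ j ^ k)

/-- The scalar field
`R_m = Σ_{α : Σ k α_k = m} Π_k Q_k^{α_k} / (α_k! (2k)^{α_k})` (so `R_0 = 1`). -/
noncomputable def Rfield {J : Type*} (Ebot : ℝ) (Em Ep : J → ℝ) (m : ℕ)
    (φ : J → Real.Angle) : ℝ :=
  ∑ α ∈ (Fintype.piFinset fun _ : Fin m => Finset.range (m + 1)).filter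
      (fun α => ∑ i, (i.1 + 1) * α i = m),
    ∏ i, Qfield Ebot Em Ep (i.1 + 1) φ ^ α i /
      (((α i).factorial * (2 * (i.1 + 1)) ^ α i : ℕ) : ℝ)

/-- The Dubrovin vector field component
`Ψ_j(φ) = 2 √((μ_j − E̲) Π_{ℓ≠j} (E_ℓ^- − μ_j)(E_ℓ^+ − μ_j)/(μ_ℓ − μ_j)²)`. -/
noncomputable def Psifield {J : Type*} (Ebot : ℝ) (Em Ep : J → ℝ)
    (φ : J → Real.Angle) (j : J) : ℝ :=
  2 * Real.sqrt ((gapMu Em Ep φ j - Ebot) *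
    ∏' l : {l : J // l ≠ j},
      ((Em l.1 - gapMu Em Ep φ j) * (Ep l.1 - gapMu Em Ep φ j)) /
        (gapMu Em Ep φ l.1 - gapMu Em Ep φ j) ^ 2)

/-- The KdV-n Dubrovin-type vector field component
`Ξ_j(φ) = (Σ_{ℓ=0}^n R_{n−ℓ}(φ) μ_j(φ)^ℓ) Ψ_j(φ)`. -/
noncomputable def Xifield {J : Type*} (Ebot : ℝ) (Em Ep : J → ℝ) (n : ℕ)
    (φ : J → Real.Angle) (j : J) : ℝ :=
  (∑ l ∈ Finset.range (n + 1), Rfield Ebot Em Ep (n - l) φ * gapMu Em Ep φ j ^ l) *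
    Psifield Ebot Em Ep φ j

/-- Two angles have real representatives realizing their distance. -/
lemma Real.Angle.exists_abs_sub_eq_dist (θ ψ : Real.Angle) :
    ∃ x y : ℝ, (x : Real.Angle) = θ ∧ (y : Real.Angle) = ψ ∧ |x - y| = dist θ ψ := by
  induction θ using Real.Angle.induction_on with
  | _ a =>
  induction ψ using Real.Angle.induction_on with
  | _ b =>
  refine ⟨a - round ((2 * Real.pi)⁻¹ * (a - b)) * (2 * Real.pi), b, ?_, rfl, ?_⟩
  · rw [Real.Angle.angle_eq_iff_two_pi_dvd_sub]
    exact ⟨-round ((2 * Real.pi)⁻¹ * (a - b)), by push_cast; ring⟩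
  · have h : dist (a : Real.Angle) (b : Real.Angle) = ‖((a - b : ℝ) : AddCircle (2 * Real.pi))‖ :=
      dist_eq_norm (E := Real.Angle) _ _
    rw [h, AddCircle.norm_eq]
    congr 1
    ring

lemma Real.Angle.dist_le_pi (θ ψ : Real.Angle) : dist θ ψ ≤ Real.pi := by
  have h : dist θ ψ = ‖(show AddCircle (2 * Real.pi) from θ - ψ)‖ :=
    dist_eq_norm (E := Real.Angle) _ _
  have h2 := AddCircle.norm_le_half_period (2 * Real.pi)
    (x := (show AddCircle (2 * Real.pi) from θ - ψ)) (by positivity)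
  rw [abs_of_pos (by positivity)] at h2
  linarith

lemma Real.Angle.abs_cos_sub_cos_le_dist (θ ψ : Real.Angle) :
    |θ.cos - ψ.cos| ≤ dist θ ψ := by
  obtain ⟨x, y, rfl, rfl, h⟩ := Real.Angle.exists_abs_sub_eq_dist θ ψ
  rw [← h]
  exact Real.abs_cos_sub_cos_le x y

lemma Real.Angle.abs_cos_le_one (θ : Real.Angle) : |θ.cos| ≤ 1 := by
  induction θ using Real.Angle.induction_on with
  | _ x => exact Real.abs_cos_le_one x

/-- The logarithm is `δ⁻¹`-Lipschitz on each of the half-lines `x ≥ δ` and `x ≤ -δ`. -/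
lemma abs_log_sub_log_le {δ x y : ℝ} (hδ : 0 < δ)
    (h : (δ ≤ x ∧ δ ≤ y) ∨ (x ≤ -δ ∧ y ≤ -δ)) :
    |Real.log x - Real.log y| ≤ |x - y| / δ := by
  have key : ∀ x y : ℝ, δ ≤ x → δ ≤ y → Real.log x - Real.log y ≤ |x - y| / δ := by
    intro x y hx hy
    have hx0 : 0 < x := hδ.trans_le hx
    have hy0 : 0 < y := hδ.trans_le hy
    rw [← Real.log_div hx0.ne' hy0.ne']
    calc Real.log (x / y) ≤ x / y - 1 := Real.log_le_sub_one_of_pos (by positivity)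
      _ = (x - y) / y := by field_simp
      _ ≤ |x - y| / y := by gcongr; exact le_abs_self _
      _ ≤ |x - y| / δ := by gcongr
  have pos : ∀ x y : ℝ, δ ≤ x → δ ≤ y → |Real.log x - Real.log y| ≤ |x - y| / δ := by
    intro x y hx hy
    rw [abs_sub_le_iff]
    refine ⟨key x y hx hy, ?_⟩
    rw [abs_sub_comm]
    exact key y x hy hx
  rcases h with h | h
  · exact pos x y h.1 h.2
  · have := pos (-x) (-y) (by linarith [h.1]) (by linarith [h.2])
    rwa [Real.log_neg_eq_log, Real.log_neg_eq_log, neg_sub_neg, abs_sub_comm y x] at this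

lemma abs_inv_add_inv_sub_two_mul_inv_le {u v m : ℝ} (hum : u ≤ m) (hmv : m ≤ v)
    (h : 0 < u ∨ v < 0) : |1 / u + 1 / v - 2 / m| ≤ (v - u) / (u * v) := by
  have e : (v - u) / (u * v) = 1 / u - 1 / v := by
    rcases h with h | h
    · have : 0 < v := by linarith
      field_simp
    · have hu : u < 0 := by linarith
      have := h.ne
      have := hu.ne
      field_simp
  have h1 : 1 / v ≤ 1 / m ∧ 1 / m ≤ 1 / u := by
    rcases h with h | h
    · exact ⟨one_div_le_one_div_of_le (by linarith) hmv, one_div_le_one_div_of_le h hum⟩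
    · exact ⟨one_div_le_one_div_of_neg_of_le h hmv,
        one_div_le_one_div_of_neg_of_le (by linarith) hum⟩
  rw [e, abs_le, show 2 / m = 1 / m + 1 / m by ring]
  constructor <;> linarith [h1.1, h1.2]

/-- The factor of the Dubrovin product coming from the gap `(p, q)` with Dirichlet datum `m`,
seen from the point `x`. -/
noncomputable def gapFactor (p q m x : ℝ) : ℝ := ((p - x) * (q - x)) / (m - x) ^ 2

/-- The point `x` lies at distance at least `δ` from the interval `[p, q]`. -/
def IsSeparated (δ x p q : ℝ) : Prop := x + δ ≤ p ∨ q + δ ≤ x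

section gapFactor

variable {δ p q m x : ℝ}

lemma gapFactor_pos (hδ : 0 < δ) (hpm : p ≤ m) (hmq : m ≤ q) (h : IsSeparated δ x p q) :
    0 < gapFactor p q m x := by
  unfold gapFactor
  rcases h with h | h
  · have h1 : 0 < p - x := by linarith
    have h2 : 0 < q - x := by linarith
    have h3 : 0 < m - x := by linarith
    positivity
  · have h1 : p - x < 0 := by linarith
    have h2 : q - x < 0 := by linarith
    have h3 : m - x ≠ 0 := by linarith
    have := mul_pos_of_neg_of_neg h1 h2
    positivity

lemma gapFactor_le (hδ : 0 < δ) (hpm : p ≤ m) (hmq : m ≤ q) (h : IsSeparated δ x p q) :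
    gapFactor p q m x ≤ 1 + (q - p) / δ := by
  have key : ∀ u v w : ℝ, δ ≤ u → u ≤ w → w ≤ v → u * v / w ^ 2 ≤ 1 + (v - u) / δ := by
    intro u v w h1 h2 h3
    have hu : 0 < u := by linarith
    have hw : 0 < w := by linarith
    have hv : 0 < v := by linarith
    calc u * v / w ^ 2 ≤ u * v / u ^ 2 := by gcongr
      _ = 1 + (v - u) / u := by field_simp; ring
      _ ≤ 1 + (v - u) / δ := by
        have : 0 ≤ v - u := by linarith
        gcongr
  unfold gapFactor
  rcases h with h | h
  · have := key (p - x) (q - x) (m - x) (by linarith) (by linarith) (by linarith)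
    convert this using 3
    ring
  · have := key (x - q) (x - p) (x - m) (by linarith) (by linarith) (by linarith)
    convert this using 2 <;> ring

lemma log_gapFactor (hδ : 0 < δ) (hpm : p ≤ m) (hmq : m ≤ q) (h : IsSeparated δ x p q) :
    Real.log (gapFactor p q m x) =
      Real.log (p - x) + Real.log (q - x) - 2 * Real.log (m - x) := by
  have h1 : p - x ≠ 0 := by rcases h with h | h <;> intro h' <;> linarith
  have h2 : q - x ≠ 0 := by rcases h with h | h <;> intro h' <;> linarith
  have h3 : m - x ≠ 0 := by rcases h with h | h <;> intro h' <;> linarith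
  rw [gapFactor, Real.log_div (by positivity) (by positivity), Real.log_mul h1 h2, Real.log_pow]
  norm_num

lemma abs_log_gapFactor_le (hδ : 0 < δ) (hpm : p ≤ m) (hmq : m ≤ q)
    (h : IsSeparated δ x p q) : |Real.log (gapFactor p q m x)| ≤ (q - p) / δ := by
  have h1 : |Real.log (p - x) - Real.log (m - x)| ≤ |p - x - (m - x)| / δ := by
    apply abs_log_sub_log_le hδ
    rcases h with h | h
    · left; constructor <;> linarith
    · right; constructor <;> linarith
  have h2 : |Real.log (q - x) - Real.log (m - x)| ≤ |q - x - (m - x)| / δ := by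
    apply abs_log_sub_log_le hδ
    rcases h with h | h
    · left; constructor <;> linarith
    · right; constructor <;> linarith
  rw [show p - x - (m - x) = -(m - p) by ring, abs_neg,
    abs_of_nonneg (show 0 ≤ m - p by linarith)] at h1
  rw [show q - x - (m - x) = q - m by ring,
    abs_of_nonneg (show 0 ≤ q - m by linarith)] at h2
  rw [log_gapFactor hδ hpm hmq h]
  calc _ = |(Real.log (p - x) - Real.log (m - x)) + (Real.log (q - x) - Real.log (m - x))| := by
        congr 1; ring
    _ ≤ (m - p) / δ + (q - m) / δ := (abs_add_le _ _).trans (add_le_add h1 h2)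
    _ = (q - p) / δ := by ring

lemma abs_log_gapFactor_sub_log_gapFactor_le {m' : ℝ} (hδ : 0 < δ) (hpm : p ≤ m) (hmq : m ≤ q)
    (hpm' : p ≤ m') (hmq' : m' ≤ q) (h : IsSeparated δ x p q) :
    |Real.log (gapFactor p q m x) - Real.log (gapFactor p q m' x)| ≤ 2 * (|m - m'| / δ) := by
  have h1 : |Real.log (m' - x) - Real.log (m - x)| ≤ |m' - x - (m - x)| / δ := by
    apply abs_log_sub_log_le hδ
    rcases h with h | h
    · left; constructor <;> linarith
    · right; constructor <;> linarith
  rw [show m' - x - (m - x) = m' - m by ring, abs_sub_comm m' m] at h1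
  rw [log_gapFactor hδ hpm hmq h, log_gapFactor hδ hpm' hmq' h]
  calc _ = |2 * (Real.log (m' - x) - Real.log (m - x))| := by congr 1; ring
    _ = 2 * |Real.log (m' - x) - Real.log (m - x)| := by rw [abs_mul, abs_two]
    _ ≤ _ := by gcongr

/-- As a function of the angle parametrizing the base point in `[a, b]`, the logarithm of the
factor of the gap `(p, q)` is Lipschitz with constant `√(q - p) √(b - a) / δ`. The vanishing of
the derivative of the parametrization at the edges is what keeps the constant this small. -/
lemma abs_log_gapFactor_cos_sub_le {a b : ℝ} (hδ : 0 < δ) (hab : a ≤ b) (hpm : p ≤ m)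
    (hmq : m ≤ q) (h : b + δ ≤ p ∨ q + δ ≤ a) (s t : ℝ) :
    |Real.log (gapFactor p q m (a + (b - a) * (1 + Real.cos s) / 2)) -
      Real.log (gapFactor p q m (a + (b - a) * (1 + Real.cos t) / 2))| ≤
      √(q - p) * √(b - a) / δ * |s - t| := by
  set μ : ℝ → ℝ := fun r => a + (b - a) * (1 + Real.cos r) / 2 with hμ
  have hba : 0 ≤ b - a := by linarith
  have hμa : ∀ r, a ≤ μ r := fun r => by
    have := Real.neg_one_le_cos r
    simp only [hμ]
    nlinarith
  have hμb : ∀ r, μ r ≤ b := fun r => by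
    have := Real.cos_le_one r
    simp only [hμ]
    nlinarith
  have hsep : ∀ r, IsSeparated δ (μ r) p q := fun r => by
    rcases h with h | h
    · left; linarith [hμb r]
    · right; linarith [hμa r]
  set f : ℝ → ℝ := fun r => Real.log (p - μ r) + Real.log (q - μ r) - 2 * Real.log (m - μ r)
    with hf
  set f' : ℝ → ℝ := fun r =>
    (b - a) * Real.sin r / 2 * (1 / (p - μ r) + 1 / (q - μ r) - 2 / (m - μ r)) with hf'
  have hμd : ∀ r c, HasDerivAt (fun r => c - μ r) ((b - a) * Real.sin r / 2) r := fun r c => by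
    have := (((((Real.hasDerivAt_cos r).const_add 1).const_mul (b - a)).div_const 2).const_add
      a).const_sub c
    exact this.congr_deriv (by ring)
  have hd : ∀ r ∈ Set.univ, HasDerivWithinAt f (f' r) Set.univ r := fun r _ => by
    have h1 : p - μ r ≠ 0 := by rcases hsep r with h | h <;> intro h' <;> linarith
    have h2 : q - μ r ≠ 0 := by rcases hsep r with h | h <;> intro h' <;> linarith
    have h3 : m - μ r ≠ 0 := by rcases hsep r with h | h <;> intro h' <;> linarith
    have := (((hμd r p).log h1).add ((hμd r q).log h2)).sub (((hμd r m).log h3).const_mul 2)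
    refine (HasDerivAt.congr_deriv this ?_).hasDerivWithinAt
    simp only [hf']
    ring
  have hb : ∀ r ∈ Set.univ, ‖f' r‖ ≤ √(q - p) * √(b - a) / δ := fun r _ => by
    have hqp : 0 ≤ q - p := by linarith
    apply abs_le_of_sq_le_sq _ (by positivity)
    have hμ' : ((b - a) * Real.sin r / 2) ^ 2 = (b - μ r) * (μ r - a) := by
      have := Real.sin_sq_add_cos_sq r
      simp only [hμ]
      linear_combination (b - a) ^ 2 / 4 * this
    have hB := abs_inv_add_inv_sub_two_mul_inv_le (u := p - μ r) (v := q - μ r) (m := m - μ r)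
      (by linarith) (by linarith) (by rcases hsep r with h | h <;> [left; right] <;> linarith)
    rw [show q - μ r - (p - μ r) = q - p by ring] at hB
    have hB2 := sq_le_sq' (by linarith [abs_nonneg (1 / (p - μ r) + 1 / (q - μ r) - 2 / (m - μ r))])
      hB
    rw [sq_abs] at hB2
    have huv : 0 < (p - μ r) * (q - μ r) := by
      rcases hsep r with h | h
      · exact mul_pos (by linarith) (by linarith)
      · exact mul_pos_of_neg_of_neg (by linarith) (by linarith)
    have hs : 0 ≤ μ r - a := by linarith [hμa r]
    have ht : 0 ≤ b - μ r := by linarith [hμb r]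
    have hδuv : δ ^ 2 ≤ (p - μ r) * (q - μ r) := by
      rcases hsep r with h | h <;> nlinarith
    have hmain : (b - μ r) * (μ r - a) * (q - p) ≤ (b - a) * ((p - μ r) * (q - μ r)) := by
      rcases h with h | h
      · have h1 : (b - μ r) * (q - p) ≤ (p - μ r) * (q - μ r) :=
          mul_le_mul (by linarith) (by linarith [hμb r]) hqp (by linarith [hμb r])
        nlinarith
      · have h1 : (μ r - a) * (q - p) ≤ (μ r - q) * (μ r - p) :=
          mul_le_mul (by linarith) (by linarith [hμa r]) hqp (by linarith [hμa r])
        nlinarith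
    calc f' r ^ 2 = (b - μ r) * (μ r - a) *
          (1 / (p - μ r) + 1 / (q - μ r) - 2 / (m - μ r)) ^ 2 := by
          rw [← hμ']; simp only [hf']; ring
      _ ≤ (b - μ r) * (μ r - a) * ((q - p) / ((p - μ r) * (q - μ r))) ^ 2 := by gcongr
      _ = ((b - μ r) * (μ r - a) * (q - p)) * (q - p) / ((p - μ r) * (q - μ r)) ^ 2 := by
          rw [div_pow]; ring
      _ ≤ ((b - a) * ((p - μ r) * (q - μ r))) * (q - p) / ((p - μ r) * (q - μ r)) ^ 2 := by gcongr
      _ = (b - a) * (q - p) / ((p - μ r) * (q - μ r)) := by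
          have := huv.ne'
          field_simp
      _ ≤ (b - a) * (q - p) / δ ^ 2 := by gcongr
      _ = _ := by rw [div_pow, mul_pow, Real.sq_sqrt hqp, Real.sq_sqrt hba, mul_comm (b - a)]
  have := convex_univ.norm_image_sub_le_of_norm_hasDerivWithin_le hd hb (Set.mem_univ t)
    (Set.mem_univ s)
  rw [log_gapFactor hδ hpm hmq (hsep s), log_gapFactor hδ hpm hmq (hsep t)]
  exact this

end gapFactor

section gapMu

variable {J : Type*} {Em Ep : J → ℝ} {j : J}

lemma le_gapMu (h : Em j < Ep j) (φ : J → Real.Angle) : Em j ≤ gapMu Em Ep φ j := by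
  have := abs_le.1 (Real.Angle.abs_cos_le_one (φ j))
  unfold gapMu
  nlinarith [this.1, this.2]

lemma gapMu_le (h : Em j < Ep j) (φ : J → Real.Angle) : gapMu Em Ep φ j ≤ Ep j := by
  have := abs_le.1 (Real.Angle.abs_cos_le_one (φ j))
  unfold gapMu
  nlinarith [this.1, this.2]

lemma abs_gapMu_sub_gapMu_le (h : Em j < Ep j) (φ ψ : J → Real.Angle) :
    |gapMu Em Ep φ j - gapMu Em Ep ψ j| ≤ (Ep j - Em j) / 2 * dist (φ j) (ψ j) := by
  have e : gapMu Em Ep φ j - gapMu Em Ep ψ j =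
      (Ep j - Em j) / 2 * ((φ j).cos - (ψ j).cos) := by
    unfold gapMu
    ring
  have h0 : 0 ≤ (Ep j - Em j) / 2 := by linarith
  rw [e, abs_mul, abs_of_nonneg h0]
  exact mul_le_mul_of_nonneg_left (Real.Angle.abs_cos_sub_cos_le_dist _ _) h0

end gapMu

lemma abs_exp_sub_exp_le {x y c : ℝ} (hx : Real.exp x ≤ c) (hy : Real.exp y ≤ c) :
    |Real.exp x - Real.exp y| ≤ c * |x - y| := by
  have key : ∀ x y : ℝ, Real.exp x ≤ c → Real.exp x - Real.exp y ≤ c * |x - y| := by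
    intro x y hx
    have h1 : Real.exp x - Real.exp y = Real.exp x * (1 - Real.exp (y - x)) := by
      rw [Real.exp_sub]
      have := Real.exp_pos x
      field_simp
    have h2 : 1 - Real.exp (y - x) ≤ |x - y| := by
      have := Real.add_one_le_exp (y - x)
      have := le_abs_self (x - y)
      linarith
    rw [h1]
    calc Real.exp x * (1 - Real.exp (y - x)) ≤ Real.exp x * |x - y| := by gcongr
      _ ≤ c * |x - y| := by gcongr
  rw [abs_sub_le_iff]
  refine ⟨key x y hx, ?_⟩
  rw [abs_sub_comm]
  exact key y x hy

section Psifield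

variable {J : Type*} {Ebot : ℝ} {Em Ep : J → ℝ} {η : J → J → ℝ}

/-- The logarithm of `Ψ_j / 2`. -/
noncomputable def logPsi (Ebot : ℝ) (Em Ep : J → ℝ) (φ : J → Real.Angle) (j : J) : ℝ :=
  (Real.log (gapMu Em Ep φ j - Ebot) + ∑' l : {l : J // l ≠ j},
    Real.log (gapFactor (Em l.1) (Ep l.1) (gapMu Em Ep φ l.1) (gapMu Em Ep φ j))) / 2

lemma isSeparated_gapMu (hlt : ∀ j, Em j < Ep j)
    (hsep : ∀ j k, j ≠ k → Ep j + η j k ≤ Em k ∨ Ep k + η j k ≤ Em j)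
    (φ : J → Real.Angle) {j l : J} (hl : l ≠ j) :
    IsSeparated (η j l) (gapMu Em Ep φ j) (Em l) (Ep l) := by
  have h1 := le_gapMu (hlt j) φ
  have h2 := gapMu_le (hlt j) φ
  rcases hsep j l hl.symm with h | h
  · left; linarith
  · right; linarith

lemma summable_log_gapFactor (hlt : ∀ j, Em j < Ep j) (hη : ∀ j k, j ≠ k → 0 < η j k)
    (hsep : ∀ j k, j ≠ k → Ep j + η j k ≤ Em k ∨ Ep k + η j k ≤ Em j) {j : J}
    (hs : Summable fun l : {l : J // l ≠ j} => (Ep l.1 - Em l.1) / η j l.1)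
    (φ : J → Real.Angle) :
    Summable fun l : {l : J // l ≠ j} =>
      Real.log (gapFactor (Em l.1) (Ep l.1) (gapMu Em Ep φ l.1) (gapMu Em Ep φ j)) :=
  Summable.of_norm_bounded hs fun l =>
    abs_log_gapFactor_le (hη _ _ l.2.symm) (le_gapMu (hlt _) φ) (gapMu_le (hlt _) φ)
      (isSeparated_gapMu hlt hsep φ l.2)

lemma Psifield_eq_two_mul_exp (hlt : ∀ j, Em j < Ep j) (hη : ∀ j k, j ≠ k → 0 < η j k)
    (hsep : ∀ j k, j ≠ k → Ep j + η j k ≤ Em k ∨ Ep k + η j k ≤ Em j)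
    (h0 : ∀ j, 0 < Em j - Ebot) {j : J}
    (hs : Summable fun l : {l : J // l ≠ j} => (Ep l.1 - Em l.1) / η j l.1)
    (φ : J → Real.Angle) :
    Psifield Ebot Em Ep φ j = 2 * Real.exp (logPsi Ebot Em Ep φ j) := by
  have hμ : 0 < gapMu Em Ep φ j - Ebot := by linarith [h0 j, le_gapMu (hlt j) φ]
  have hpos : ∀ l : {l : J // l ≠ j},
      0 < gapFactor (Em l.1) (Ep l.1) (gapMu Em Ep φ l.1) (gapMu Em Ep φ j) := fun l =>
    gapFactor_pos (hη _ _ l.2.symm) (le_gapMu (hlt _) φ) (gapMu_le (hlt _) φ)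
      (isSeparated_gapMu hlt hsep φ l.2)
  rw [logPsi, Real.exp_half, Real.exp_add, Real.exp_log hμ,
    Real.rexp_tsum_eq_tprod hpos (summable_log_gapFactor hlt hη hsep hs φ)]
  rfl

lemma exp_logPsi_le (hlt : ∀ j, Em j < Ep j) (hη : ∀ j k, j ≠ k → 0 < η j k)
    (hsep : ∀ j k, j ≠ k → Ep j + η j k ≤ Em k ∨ Ep k + η j k ≤ Em j)
    (h0 : ∀ j, 0 < Em j - Ebot) {j : J}
    (hs : Summable fun l : {l : J // l ≠ j} => (Ep l.1 - Em l.1) / η j l.1)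
    (φ : J → Real.Angle) :
    Real.exp (logPsi Ebot Em Ep φ j) ≤ √((Em j - Ebot) + (Ep j - Em j)) *
      ∏' l : {l : J // l ≠ j}, √(1 + (Ep l.1 - Em l.1) / η j l.1) := by
  have hμ : 0 < gapMu Em Ep φ j - Ebot := by linarith [h0 j, le_gapMu (hlt j) φ]
  have hx : ∀ l : {l : J // l ≠ j}, 0 < (Ep l.1 - Em l.1) / η j l.1 := fun l =>
    div_pos (by linarith [hlt l.1]) (hη _ _ l.2.symm)
  have hlog : ∀ l : {l : J // l ≠ j}, Real.log (√(1 + (Ep l.1 - Em l.1) / η j l.1)) =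
      Real.log (1 + (Ep l.1 - Em l.1) / η j l.1) / 2 := fun l =>
    Real.log_sqrt (by linarith [hx l])
  have hsum : Summable fun l : {l : J // l ≠ j} =>
      Real.log (√(1 + (Ep l.1 - Em l.1) / η j l.1)) := by
    refine Summable.of_norm_bounded hs fun l => ?_
    have h1 := hx l
    have h2 := Real.log_le_sub_one_of_pos (show 0 < 1 + (Ep l.1 - Em l.1) / η j l.1 by linarith)
    have h3 := Real.log_nonneg (show 1 ≤ 1 + (Ep l.1 - Em l.1) / η j l.1 by linarith)
    rw [hlog, Real.norm_eq_abs, abs_of_nonneg (by linarith)]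
    linarith
  have hprod := Real.rexp_tsum_eq_tprod
    (fun l => Real.sqrt_pos.2 (by linarith [hx l])) hsum
  have htop : √((Em j - Ebot) + (Ep j - Em j)) =
      Real.exp (Real.log ((Em j - Ebot) + (Ep j - Em j)) / 2) := by
    rw [Real.exp_half, Real.exp_log (by linarith [hlt j, h0 j])]
  rw [← hprod, htop, ← Real.exp_add, Real.exp_le_exp, logPsi, add_div, ← tsum_div_const]
  refine add_le_add ?_ (Summable.tsum_le_tsum (fun l => ?_)
    ((summable_log_gapFactor hlt hη hsep hs φ).div_const 2) hsum)
  · gcongr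
    linarith [gapMu_le (hlt j) φ]
  · have hF := isSeparated_gapMu hlt hsep φ l.2
    rw [hlog]
    gcongr
    · exact gapFactor_pos (hη _ _ l.2.symm) (le_gapMu (hlt _) φ) (gapMu_le (hlt _) φ) hF
    · exact gapFactor_le (hη _ _ l.2.symm) (le_gapMu (hlt _) φ) (gapMu_le (hlt _) φ) hF

lemma abs_log_gapFactor_gapMu_sub_le (hlt : ∀ j, Em j < Ep j) (hη : ∀ j k, j ≠ k → 0 < η j k)
    (hsep : ∀ j k, j ≠ k → Ep j + η j k ≤ Em k ∨ Ep k + η j k ≤ Em j)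
    (φ ψ : J → Real.Angle) {j l : J} (hl : l ≠ j) :
    |Real.log (gapFactor (Em l) (Ep l) (gapMu Em Ep φ l) (gapMu Em Ep φ j)) -
      Real.log (gapFactor (Em l) (Ep l) (gapMu Em Ep ψ l) (gapMu Em Ep ψ j))| ≤
    √(Ep l - Em l) * √(Ep j - Em j) / η j l * dist (φ j) (ψ j) +
      (Ep l - Em l) / η j l * dist (φ l) (ψ l) := by
  have hδ := hη j l hl.symm
  refine (abs_sub_le _
    (Real.log (gapFactor (Em l) (Ep l) (gapMu Em Ep φ l) (gapMu Em Ep ψ j))) _).trans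
    (add_le_add ?_ ?_)
  · obtain ⟨s, t, hs, ht, hd⟩ := Real.Angle.exists_abs_sub_eq_dist (φ j) (ψ j)
    have := abs_log_gapFactor_cos_sub_le hδ (hlt j).le (le_gapMu (hlt l) φ)
      (gapMu_le (hlt l) φ) (hsep j l hl.symm) s t
    rw [hd, ← Real.Angle.cos_coe, ← Real.Angle.cos_coe, hs, ht] at this
    exact this
  · refine (abs_log_gapFactor_sub_log_gapFactor_le hδ (le_gapMu (hlt l) φ)
      (gapMu_le (hlt l) φ) (le_gapMu (hlt l) ψ) (gapMu_le (hlt l) ψ)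
      (isSeparated_gapMu hlt hsep ψ hl)).trans ?_
    have := abs_gapMu_sub_gapMu_le (hlt l) φ ψ
    calc 2 * (|gapMu Em Ep φ l - gapMu Em Ep ψ l| / η j l)
        ≤ 2 * ((Ep l - Em l) / 2 * dist (φ l) (ψ l) / η j l) := by gcongr
      _ = _ := by ring

lemma mul_abs_logPsi_sub_logPsi_le (hlt : ∀ j, Em j < Ep j) (hη : ∀ j k, j ≠ k → 0 < η j k)
    (hsep : ∀ j k, j ≠ k → Ep j + η j k ≤ Em k ∨ Ep k + η j k ≤ Em j)
    (h0 : ∀ j, 0 < Em j - Ebot) {N : J → ℝ}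
    (hN : ∀ j, 1 ≤ N j) {j : J}
    (hs : Summable fun l : {l : J // l ≠ j} => (Ep l.1 - Em l.1) / η j l.1)
    (hs' : Summable fun l : {l : J // l ≠ j} =>
      √(Ep l.1 - Em l.1) * √(Ep j - Em j) / η j l.1)
    {φ ψ : J → Real.Angle} {D : ℝ}
    (hD : ∀ k, √((Ep k - Em k) * N k) * dist (φ k) (ψ k) ≤ D) :
    √((Ep j - Em j) * N j) * |logPsi Ebot Em Ep φ j - logPsi Ebot Em Ep ψ j| ≤
      ((Ep j - Em j) / (4 * (Em j - Ebot)) + √(N j) *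
        ∑' l : {l : J // l ≠ j}, √(Ep l.1 - Em l.1) * √(Ep j - Em j) / η j l.1) * D := by
  set w := √((Ep j - Em j) * N j) with hw
  set Δ : {l : J // l ≠ j} → ℝ := fun l =>
    Real.log (gapFactor (Em l.1) (Ep l.1) (gapMu Em Ep φ l.1) (gapMu Em Ep φ j)) -
      Real.log (gapFactor (Em l.1) (Ep l.1) (gapMu Em Ep ψ l.1) (gapMu Em Ep ψ j))
  set c : {l : J // l ≠ j} → ℝ := fun l => √(Ep l.1 - Em l.1) * √(Ep j - Em j) / η j l.1
    with hc
  have hγ : ∀ k, 0 < Ep k - Em k := fun k => by linarith [hlt k]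
  have hw0 : 0 ≤ w := Real.sqrt_nonneg _
  have hwj : w = √(Ep j - Em j) * √(N j) := Real.sqrt_mul (hγ j).le _
  have hD0 : 0 ≤ D := (mul_nonneg (Real.sqrt_nonneg _) dist_nonneg).trans (hD j)
  have hNj : 1 ≤ √(N j) := Real.one_le_sqrt.2 (hN j)
  have hfirst : w * |Real.log (gapMu Em Ep φ j - Ebot) - Real.log (gapMu Em Ep ψ j - Ebot)| ≤
      (Ep j - Em j) / (2 * (Em j - Ebot)) * D := by
    have h1 := abs_log_sub_log_le (h0 j) (x := gapMu Em Ep φ j - Ebot)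
      (y := gapMu Em Ep ψ j - Ebot)
      (.inl ⟨by linarith [le_gapMu (hlt j) φ], by linarith [le_gapMu (hlt j) ψ]⟩)
    rw [sub_sub_sub_cancel_right] at h1
    have h2 := abs_gapMu_sub_gapMu_le (hlt j) φ ψ
    have h3 := h0 j
    have h4 := hγ j
    calc _ ≤ w * ((Ep j - Em j) / 2 * dist (φ j) (ψ j) / (Em j - Ebot)) := by
          gcongr
          exact h1.trans (by gcongr)
      _ = (Ep j - Em j) / (2 * (Em j - Ebot)) * (w * dist (φ j) (ψ j)) := by
          field_simp
      _ ≤ _ := by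
          gcongr
          exact hD j
  have hterm : ∀ l, ‖w * Δ l‖ ≤ 2 * √(N j) * D * c l := fun l => by
    have hδ := hη _ _ l.2.symm
    have hc0 : 0 ≤ c l := by positivity
    have h1 := abs_log_gapFactor_gapMu_sub_le hlt hη hsep φ ψ l.2
    have h2 : √(Ep l.1 - Em l.1) * dist (φ l.1) (ψ l.1) ≤ D := by
      refine le_trans ?_ (hD l.1)
      gcongr
      exact le_mul_of_one_le_right (hγ _).le (hN _)
    rw [norm_mul, Real.norm_eq_abs, Real.norm_eq_abs, abs_of_nonneg hw0]
    have h3 : (Ep l.1 - Em l.1) / η j l.1 * dist (φ l.1) (ψ l.1) =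
        √(Ep l.1 - Em l.1) / η j l.1 * (√(Ep l.1 - Em l.1) * dist (φ l.1) (ψ l.1)) := by
      conv_lhs => rw [← Real.mul_self_sqrt (hγ l.1).le]
      ring
    calc w * |Δ l| ≤ w * (c l * dist (φ j) (ψ j) +
          (Ep l.1 - Em l.1) / η j l.1 * dist (φ l.1) (ψ l.1)) := by gcongr
      _ = c l * (w * dist (φ j) (ψ j)) +
          w * (√(Ep l.1 - Em l.1) / η j l.1 * (√(Ep l.1 - Em l.1) * dist (φ l.1) (ψ l.1))) := by
          rw [h3]; ring
      _ ≤ c l * D + w * (√(Ep l.1 - Em l.1) / η j l.1 * D) := by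
          gcongr
          exact hD j
      _ = c l * D * 1 + √(N j) * D * c l := by rw [hwj]; simp only [hc]; ring
      _ ≤ c l * D * √(N j) + √(N j) * D * c l := by gcongr
      _ = _ := by ring
  have htsum : |w * ∑' l, Δ l| ≤ 2 * √(N j) * D * ∑' l, c l := by
    rw [← tsum_mul_left]
    exact tsum_of_norm_bounded (hs'.hasSum.mul_left _) hterm
  have hsub : (∑' l : {l : J // l ≠ j},
        Real.log (gapFactor (Em l.1) (Ep l.1) (gapMu Em Ep φ l.1) (gapMu Em Ep φ j))) -
      ∑' l : {l : J // l ≠ j},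
        Real.log (gapFactor (Em l.1) (Ep l.1) (gapMu Em Ep ψ l.1) (gapMu Em Ep ψ j)) =
      ∑' l, Δ l :=
    ((summable_log_gapFactor hlt hη hsep hs φ).tsum_sub
      (summable_log_gapFactor hlt hη hsep hs ψ)).symm
  rw [abs_mul, abs_of_nonneg hw0] at htsum
  calc w * |logPsi Ebot Em Ep φ j - logPsi Ebot Em Ep ψ j|
      = w * (|(Real.log (gapMu Em Ep φ j - Ebot) - Real.log (gapMu Em Ep ψ j - Ebot)) +
          ∑' l, Δ l| / 2) := by
        rw [← hsub, logPsi, logPsi, ← sub_div, abs_div, abs_two]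
        congr 3
        ring
    _ ≤ w * ((|Real.log (gapMu Em Ep φ j - Ebot) - Real.log (gapMu Em Ep ψ j - Ebot)| +
          |∑' l, Δ l|) / 2) := by
        gcongr
        exact abs_add_le _ _
    _ = (w * |Real.log (gapMu Em Ep φ j - Ebot) - Real.log (gapMu Em Ep ψ j - Ebot)| +
          w * |∑' l, Δ l|) / 2 := by ring
    _ ≤ ((Ep j - Em j) / (2 * (Em j - Ebot)) * D + 2 * √(N j) * D * ∑' l, c l) / 2 := by gcongr
    _ = _ := by
        have := (h0 j).ne'
        field_simp
        ring

end Psifield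

/-- The family `f · j` is bounded by a multiple of `N j` and Lipschitz for `D` with constant a
multiple of `N j`, uniformly in `j`. -/
def IsBoundedLip {X J : Type*} (D : X → X → ℝ) (N : J → ℝ) (f : X → J → ℝ) : Prop :=
  ∃ M : ℝ, 0 ≤ M ∧ ∀ x y j, |f x j| ≤ M * N j ∧ |f x j - f y j| ≤ M * N j * D x y

namespace IsBoundedLip

variable {X J ι : Type*} {D : X → X → ℝ} {N : J → ℝ} {f g : X → J → ℝ}

lemma const (hD : ∀ x y, 0 ≤ D x y) (hN : ∀ j, 1 ≤ N j) (c : ℝ) :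
    IsBoundedLip D N fun _ _ => c := by
  refine ⟨|c|, abs_nonneg c, fun x y j => ⟨le_mul_of_one_le_right (abs_nonneg c) (hN j), ?_⟩⟩
  have h1 := hD x y
  have h2 := zero_le_one.trans (hN j)
  rw [sub_self, abs_zero]
  positivity

lemma add (hf : IsBoundedLip D N f) (hg : IsBoundedLip D N g) :
    IsBoundedLip D N fun x j => f x j + g x j := by
  obtain ⟨M, hM, h⟩ := hf
  obtain ⟨M', hM', h'⟩ := hg
  refine ⟨M + M', by positivity, fun x y j => ⟨?_, ?_⟩⟩
  · rw [add_mul]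
    exact (abs_add_le _ _).trans (add_le_add (h x y j).1 (h' x y j).1)
  · rw [add_mul, add_mul, add_sub_add_comm]
    exact (abs_add_le _ _).trans (add_le_add (h x y j).2 (h' x y j).2)

lemma mul (hf : IsBoundedLip D (fun _ => 1) f) (hg : IsBoundedLip D N g) :
    IsBoundedLip D N fun x j => f x j * g x j := by
  obtain ⟨M, hM, h⟩ := hf
  obtain ⟨M', hM', h'⟩ := hg
  refine ⟨2 * (M * M'), by positivity, fun x y j => ?_⟩
  obtain ⟨h1, h2⟩ := h x y j
  obtain ⟨h3, h4⟩ := h' x y j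
  have h5 := (h' y x j).1
  rw [mul_one] at h1 h2
  have h6 : 0 ≤ M' * N j := (abs_nonneg _).trans h3
  constructor
  · rw [abs_mul]
    have : |f x j| * |g x j| ≤ M * (M' * N j) := mul_le_mul h1 h3 (abs_nonneg _) hM
    have : 0 ≤ M * (M' * N j) := mul_nonneg hM h6
    linarith
  · calc |f x j * g x j - f y j * g y j|
        = |f x j * (g x j - g y j) + (f x j - f y j) * g y j| := by congr 1; ring
      _ ≤ |f x j| * |g x j - g y j| + |f x j - f y j| * |g y j| := by
          rw [← abs_mul, ← abs_mul]
          exact abs_add_le _ _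
      _ ≤ M * (M' * N j * D x y) + M * D x y * (M' * N j) := by
          gcongr
          exact (abs_nonneg _).trans h2
      _ = _ := by ring

lemma sum (hD : ∀ x y, 0 ≤ D x y) (hN : ∀ j, 1 ≤ N j) {s : Finset ι} {F : ι → X → J → ℝ}
    (h : ∀ i ∈ s, IsBoundedLip D N (F i)) : IsBoundedLip D N fun x j => ∑ i ∈ s, F i x j := by
  have := Finset.sum_induction F (IsBoundedLip D N) (fun _ _ => add) (const hD hN 0) h
  convert this using 3
  simp

lemma prod (hD : ∀ x y, 0 ≤ D x y) {s : Finset ι} {F : ι → X → J → ℝ}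
    (h : ∀ i ∈ s, IsBoundedLip D (fun _ => 1) (F i)) :
    IsBoundedLip D (fun _ => 1) fun x j => ∏ i ∈ s, F i x j := by
  have := Finset.prod_induction F (IsBoundedLip D fun _ => 1) (fun _ _ => mul)
    (const hD (fun _ => le_rfl) 1) h
  convert this using 3
  simp

lemma pow (hD : ∀ x y, 0 ≤ D x y) (h : IsBoundedLip D (fun _ => 1) f) (k : ℕ) :
    IsBoundedLip D (fun _ => 1) fun x j => f x j ^ k := by
  simpa using prod hD (s := Finset.range k) (F := fun _ => f) fun _ _ => h

lemma div_const (hD : ∀ x y, 0 ≤ D x y) (h : IsBoundedLip D (fun _ => 1) f) (c : ℝ) :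
    IsBoundedLip D (fun _ => 1) fun x j => f x j / c := by
  simpa [div_eq_mul_inv] using h.mul (const hD (fun _ => le_rfl) c⁻¹)

end IsBoundedLip

section fields

variable {J : Type*} {Ebot : ℝ} {Em Ep : J → ℝ} {n : ℕ}

/-- Powers of order at most `n` on the gaps are bounded and Lipschitz with constants
controlled by `1 + (E_j^- - E̲)^n`. -/
lemma exists_forall_abs_pow_le (h0 : ∀ j, 0 < Em j - Ebot) {G : ℝ} (hG : 0 ≤ G)
    (hγG : ∀ j, Ep j - Em j ≤ G) {k : ℕ} (hk : k ≤ n) :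
    ∃ B : ℝ, 0 ≤ B ∧ ∀ j x y, Em j ≤ x → x ≤ Ep j → Em j ≤ y → y ≤ Ep j →
      |x ^ k| ≤ B * (1 + (Em j - Ebot) ^ n) ∧
      |x ^ k - y ^ k| ≤ B * (1 + (Em j - Ebot) ^ n) * |x - y| := by
  set A := 1 + |Ebot| + G with hA
  have hA1 : 1 ≤ A := by linarith [abs_nonneg Ebot]
  have habs : ∀ j x, Em j ≤ x → x ≤ Ep j → |x| ≤ A + (Em j - Ebot) := by
    intro j x h1 h2
    have h3 := h0 j
    have h4 := hγG j
    have h5 := neg_abs_le Ebot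
    have h6 := le_abs_self Ebot
    rw [abs_le]
    constructor <;> linarith
  have hpow : ∀ j, ∀ i ≤ n, (A + (Em j - Ebot)) ^ i ≤
      2 ^ (n - 1) * A ^ n * (1 + (Em j - Ebot) ^ n) := by
    intro j i hi
    have h3 := h0 j
    have h4 : 1 ≤ A ^ n := one_le_pow₀ hA1
    calc (A + (Em j - Ebot)) ^ i ≤ (A + (Em j - Ebot)) ^ n :=
          pow_le_pow_right₀ (by linarith) hi
      _ ≤ 2 ^ (n - 1) * (A ^ n + (Em j - Ebot) ^ n) := add_pow_le (by linarith) h3.le n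
      _ ≤ 2 ^ (n - 1) * (A ^ n + A ^ n * (Em j - Ebot) ^ n) := by
          gcongr
          exact le_mul_of_one_le_left (by positivity) h4
      _ = _ := by ring
  refine ⟨(k + 1) * (2 ^ (n - 1) * A ^ n), by positivity, fun j x y hx hx' hy hy' => ?_⟩
  have h3 := h0 j
  have hN : 0 ≤ 2 ^ (n - 1) * A ^ n * (1 + (Em j - Ebot) ^ n) := by positivity
  have hk0 : (0 : ℝ) ≤ k := Nat.cast_nonneg k
  constructor
  · calc |x ^ k| = |x| ^ k := abs_pow x k
      _ ≤ (A + (Em j - Ebot)) ^ k := pow_le_pow_left₀ (abs_nonneg x) (habs j x hx hx') k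
      _ ≤ 2 ^ (n - 1) * A ^ n * (1 + (Em j - Ebot) ^ n) := hpow j k hk
      _ ≤ _ := by nlinarith
  · calc |x ^ k - y ^ k| ≤ |x - y| * k * max |x| |y| ^ (k - 1) := abs_pow_sub_pow_le x y k
      _ ≤ |x - y| * k * (A + (Em j - Ebot)) ^ (k - 1) := by
          gcongr
          exact max_le (habs j x hx hx') (habs j y hy hy')
      _ ≤ |x - y| * k * (2 ^ (n - 1) * A ^ n * (1 + (Em j - Ebot) ^ n)) := by
          gcongr
          exact hpow j _ (by omega)
      _ ≤ |x - y| * (k + 1) * (2 ^ (n - 1) * A ^ n * (1 + (Em j - Ebot) ^ n)) := by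
          gcongr
          linarith
      _ = _ := by ring

variable {S : ℝ} {D : (J → Real.Angle) → (J → Real.Angle) → ℝ}

lemma gap_le_mul_sqrt (hlt : ∀ j, Em j < Ep j) (h0 : ∀ j, 0 < Em j - Ebot) (j : J) :
    Ep j - Em j ≤ √((Ep j - Em j) * (1 + (Em j - Ebot) ^ n)) *
      √((Ep j - Em j) * (1 + (Em j - Ebot) ^ n)) := by
  have h1 := hlt j
  have h2 := h0 j
  have h3 : 0 ≤ Ep j - Em j := by linarith
  have h4 : 0 ≤ (Em j - Ebot) ^ n := by positivity
  rw [Real.mul_self_sqrt (by positivity)]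
  nlinarith

lemma isBoundedLip_gapMu_pow (hlt : ∀ j, Em j < Ep j) (h0 : ∀ j, 0 < Em j - Ebot)
    (hS : 0 ≤ S) (hwS : ∀ j, √((Ep j - Em j) * (1 + (Em j - Ebot) ^ n)) ≤ S)
    (hD : ∀ φ ψ k, √((Ep k - Em k) * (1 + (Em k - Ebot) ^ n)) * dist (φ k) (ψ k) ≤ D φ ψ)
    {k : ℕ} (hk : k ≤ n) :
    IsBoundedLip D (fun j => 1 + (Em j - Ebot) ^ n) fun φ j => gapMu Em Ep φ j ^ k := by
  obtain ⟨B, hB, h⟩ := exists_forall_abs_pow_le (n := n) h0 (mul_nonneg hS hS) (fun j =>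
    (gap_le_mul_sqrt (n := n) hlt h0 j).trans
      (mul_le_mul (hwS j) (hwS j) (Real.sqrt_nonneg _) hS)) hk
  refine ⟨B * (1 + S), by positivity, fun φ ψ j => ?_⟩
  have h3 := h0 j
  obtain ⟨h1, h2⟩ := h j _ _ (le_gapMu (hlt j) φ) (gapMu_le (hlt j) φ) (le_gapMu (hlt j) ψ)
    (gapMu_le (hlt j) ψ)
  set w := √((Ep j - Em j) * (1 + (Em j - Ebot) ^ n)) with hw
  have hw0 : 0 ≤ w := Real.sqrt_nonneg _
  have hDj := hD φ ψ j
  have hD0 : 0 ≤ D φ ψ := (mul_nonneg hw0 dist_nonneg).trans hDj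
  have hBN : 0 ≤ B * (1 + (Em j - Ebot) ^ n) := by positivity
  constructor
  · nlinarith [mul_nonneg hS hBN]
  · have h4 : |gapMu Em Ep φ j - gapMu Em Ep ψ j| ≤ (1 + S) * D φ ψ := by
      have hd : 0 ≤ dist (φ j) (ψ j) := dist_nonneg
      have h6 : (Ep j - Em j) / 2 ≤ w * w := by
        have := gap_le_mul_sqrt (n := n) hlt h0 j
        linarith [hlt j]
      calc _ ≤ (Ep j - Em j) / 2 * dist (φ j) (ψ j) := abs_gapMu_sub_gapMu_le (hlt j) φ ψ
        _ ≤ w * w * dist (φ j) (ψ j) := by gcongr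
        _ = w * (w * dist (φ j) (ψ j)) := by ring
        _ ≤ S * D φ ψ := mul_le_mul (hwS j) hDj (by positivity) hS
        _ ≤ _ := by nlinarith
    calc _ ≤ B * (1 + (Em j - Ebot) ^ n) * ((1 + S) * D φ ψ) :=
          h2.trans (mul_le_mul_of_nonneg_left h4 hBN)
      _ = _ := by ring

lemma isBoundedLip_Qfield (hlt : ∀ j, Em j < Ep j) (h0 : ∀ j, 0 < Em j - Ebot)
    (hsum : Summable fun j => √((Ep j - Em j) * (1 + (Em j - Ebot) ^ n)))
    (hD0 : ∀ φ ψ, 0 ≤ D φ ψ)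
    (hD : ∀ φ ψ k, √((Ep k - Em k) * (1 + (Em k - Ebot) ^ n)) * dist (φ k) (ψ k) ≤ D φ ψ)
    {k : ℕ} (hk : k ≤ n) :
    IsBoundedLip D (fun _ : J => 1) fun φ _ => Qfield Ebot Em Ep k φ := by
  set w : J → ℝ := fun j => √((Ep j - Em j) * (1 + (Em j - Ebot) ^ n)) with hw
  set S := ∑' j, w j with hSdef
  have hw0 : ∀ j, 0 ≤ w j := fun j => Real.sqrt_nonneg _
  have hS : 0 ≤ S := tsum_nonneg hw0
  have hwS : ∀ j, w j ≤ S := fun j => hsum.le_tsum j fun i _ => hw0 i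
  obtain ⟨B, hB, h⟩ := exists_forall_abs_pow_le (n := n) h0 (mul_nonneg hS hS) (fun j =>
    (gap_le_mul_sqrt (n := n) hlt h0 j).trans (mul_le_mul (hwS j) (hwS j) (hw0 j) hS)) hk
  have hww : ∀ j, w j * w j = (Ep j - Em j) * (1 + (Em j - Ebot) ^ n) := fun j => by
    have h1 := hlt j
    have h2 := h0 j
    have h3 : 0 ≤ Ep j - Em j := by linarith
    exact Real.mul_self_sqrt (by positivity)
  set T : (J → Real.Angle) → J → ℝ := fun φ j =>
    Em j ^ k + Ep j ^ k - 2 * gapMu Em Ep φ j ^ k with hT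
  have hTle : ∀ φ j, ‖T φ j‖ ≤ B * S * w j := fun φ j => by
    have h1 := le_gapMu (hlt j) φ
    have h2 := gapMu_le (hlt j) φ
    have h3 := (h j _ _ le_rfl (hlt j).le h1 h2).2
    have h4 := (h j _ _ (hlt j).le le_rfl h1 h2).2
    rw [abs_sub_comm (Em j), abs_of_nonneg (sub_nonneg.2 h1)] at h3
    rw [abs_of_nonneg (sub_nonneg.2 h2)] at h4
    calc ‖T φ j‖ = |(Em j ^ k - gapMu Em Ep φ j ^ k) + (Ep j ^ k - gapMu Em Ep φ j ^ k)| := by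
          rw [Real.norm_eq_abs]
          congr 1
          simp only [hT]
          ring
      _ ≤ _ := (abs_add_le _ _).trans (add_le_add h3 h4)
      _ = B * (w j * w j) := by rw [hww]; ring
      _ ≤ B * (S * w j) := by
          have := hw0 j
          gcongr
          exact hwS j
      _ = _ := by ring
  have hTsub : ∀ φ ψ j, ‖T φ j - T ψ j‖ ≤ B * D φ ψ * w j := fun φ ψ j => by
    have h3 := (h j _ _ (le_gapMu (hlt j) φ) (gapMu_le (hlt j) φ) (le_gapMu (hlt j) ψ)
      (gapMu_le (hlt j) ψ)).2
    have hN : 0 ≤ B * (1 + (Em j - Ebot) ^ n) := by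
      have := h0 j
      positivity
    calc ‖T φ j - T ψ j‖ = 2 * |gapMu Em Ep φ j ^ k - gapMu Em Ep ψ j ^ k| := by
          rw [Real.norm_eq_abs, ← abs_two, ← abs_mul, abs_sub_comm]
          congr 1
          simp only [hT]
          ring
      _ ≤ 2 * (B * (1 + (Em j - Ebot) ^ n) * ((Ep j - Em j) / 2 * dist (φ j) (ψ j))) := by
          gcongr
          exact h3.trans (mul_le_mul_of_nonneg_left (abs_gapMu_sub_gapMu_le (hlt j) φ ψ) hN)
      _ = B * (w j * w j) * dist (φ j) (ψ j) := by rw [hww]; ring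
      _ = B * w j * (w j * dist (φ j) (ψ j)) := by ring
      _ ≤ B * w j * D φ ψ := mul_le_mul_of_nonneg_left (hD φ ψ j) (mul_nonneg hB (hw0 j))
      _ = _ := by ring
  have hTs : ∀ φ, Summable (T φ) := fun φ => Summable.of_norm_bounded (hsum.mul_left _) (hTle φ)
  refine ⟨|Ebot ^ k| + B * S * S + B * S, by positivity, fun φ ψ j => ⟨?_, ?_⟩⟩
  · have h1 : |∑' j, T φ j| ≤ B * S * S :=
      tsum_of_norm_bounded (hsum.hasSum.mul_left _) (hTle φ)
    have h2 : |Qfield Ebot Em Ep k φ| ≤ |Ebot ^ k| + |∑' j, T φ j| := abs_add_le _ _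
    have : 0 ≤ B * S := by positivity
    linarith
  · have h1 : |∑' j, (T φ j - T ψ j)| ≤ B * D φ ψ * S :=
      tsum_of_norm_bounded (hsum.hasSum.mul_left _) (hTsub φ ψ)
    rw [(hTs φ).tsum_sub (hTs ψ)] at h1
    have h2 : Qfield Ebot Em Ep k φ - Qfield Ebot Em Ep k ψ = ∑' j, T φ j - ∑' j, T ψ j :=
      add_sub_add_left_eq_sub _ _ _
    have h3 := hD0 φ ψ
    have h4 : 0 ≤ (|Ebot ^ k| + B * S * S) * D φ ψ := by positivity
    rw [h2]
    linarith

lemma isBoundedLip_Rfield (hD0 : ∀ φ ψ, 0 ≤ D φ ψ) {m : ℕ}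
    (hQ : ∀ k ≤ m, IsBoundedLip D (fun _ : J => 1) fun φ _ => Qfield Ebot Em Ep k φ) :
    IsBoundedLip D (fun _ : J => 1) fun φ _ => Rfield Ebot Em Ep m φ :=
  .sum hD0 (fun _ => le_rfl) fun _ _ => .prod hD0 fun i _ =>
    ((hQ (i.1 + 1) i.2).pow hD0 _).div_const hD0 _

end fields

lemma Real.rpow_three_halves {x : ℝ} (hx : 0 < x) : x ^ ((3 : ℝ) / 2) = x * √x := by
  rw [Real.sqrt_eq_rpow, show (3 : ℝ) / 2 = 1 + 1 / 2 by norm_num, Real.rpow_add hx,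
    Real.rpow_one]

/-- Lemma 4.4: under the Craig-type conditions (C1)–(C4) the vector field `Ξ` is Lipschitz
on the torus of Dirichlet data for the metric
`‖φ − ψ‖ = sup_j γ_j^{1/2}(1+η_{j,0}^n)^{1/2} dist(φ_j, ψ_j)`. -/
theorem Xi_Lipschitz {J : Type*} [Countable J] (Ebot : ℝ) (Em Ep : J → ℝ)
    (hlt : ∀ j, Em j < Ep j) (hbot : ∀ j, Ebot ≤ Em j)
    (hη0pos : ∀ j, 0 < Em j - Ebot)
    (η : J → J → ℝ)
    (hηpos : ∀ j k, j ≠ k → 0 < η j k)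
    (hηdist : ∀ j k, j ≠ k →
      (Ep j ≤ Em k ∧ η j k = Em k - Ep j) ∨ (Ep k ≤ Em j ∧ η j k = Em j - Ep k))
    (n : ℕ) (hn : 1 ≤ n)
    (C : J → ℝ)
    (hmult : ∀ j, Multipliable fun l : {l : J // l ≠ j} =>
      Real.sqrt (1 + (Ep l.1 - Em l.1) / η j l.1))
    (hC : ∀ j, C j = Real.sqrt ((Em j - Ebot) + (Ep j - Em j)) *
      ∏' l : {l : J // l ≠ j}, Real.sqrt (1 + (Ep l.1 - Em l.1) / η j l.1))
    (hC1 : Summable fun k => Real.sqrt ((Ep k - Em k) * (1 + (Em k - Ebot) ^ n)))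
    (hC2sum : ∀ j, Summable fun k : {k : J // k ≠ j} =>
      Real.sqrt (Ep k.1 - Em k.1) * Real.sqrt (Ep j - Em j) / η j k.1)
    (hC2 : ∃ K : ℝ, ∀ j, C j * (1 + (Em j - Ebot) ^ n) ^ ((3:ℝ)/2) *
      (∑' k : {k : J // k ≠ j},
        Real.sqrt (Ep k.1 - Em k.1) * Real.sqrt (Ep j - Em j) / η j k.1) ≤ K)
    (hC3 : ∃ K : ℝ, ∀ j,
      (Ep j - Em j) * (1 + (Em j - Ebot) ^ n) * C j / (Em j - Ebot) ≤ K)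
    (hC4 : ∃ K : ℝ, ∀ j,
      C j * Real.sqrt (Ep j - Em j) * (1 + (Em j - Ebot) ^ n) ^ ((3:ℝ)/2) ≤ K) :
    ∃ L : ℝ, ∀ φ ψ : J → Real.Angle, ∀ j : J,
      Real.sqrt ((Ep j - Em j) * (1 + (Em j - Ebot) ^ n)) *
        |Xifield Ebot Em Ep n φ j - Xifield Ebot Em Ep n ψ j| ≤
      L * ⨆ k : J, Real.sqrt ((Ep k - Em k) * (1 + (Em k - Ebot) ^ n)) *
        dist (φ k) (ψ k) := by
  obtain ⟨K₂, hK₂⟩ := hC2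
  obtain ⟨K₃, hK₃⟩ := hC3
  obtain ⟨K₄, hK₄⟩ := hC4
  set N : J → ℝ := fun j => 1 + (Em j - Ebot) ^ n with hNdef
  set w : J → ℝ := fun j => √((Ep j - Em j) * N j) with hw
  set D : (J → Real.Angle) → (J → Real.Angle) → ℝ := fun φ ψ =>
    ⨆ k : J, w k * dist (φ k) (ψ k) with hDdef
  have hγ : ∀ j, 0 < Ep j - Em j := fun j => by linarith [hlt j]
  have hN : ∀ j, 1 ≤ N j := fun j => by
    have := hη0pos j
    have : 0 ≤ (Em j - Ebot) ^ n := by positivity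
    simp only [hNdef]
    linarith
  have hw0 : ∀ j, 0 ≤ w j := fun j => Real.sqrt_nonneg _
  have hwS : ∀ j, w j ≤ ∑' j, w j := fun j => hC1.le_tsum j fun i _ => hw0 i
  have hS : 0 ≤ ∑' j, w j := tsum_nonneg hw0
  have hD : ∀ φ ψ k, w k * dist (φ k) (ψ k) ≤ D φ ψ := fun φ ψ k => by
    refine le_ciSup (f := fun k => w k * dist (φ k) (ψ k)) ⟨(∑' j, w j) * Real.pi, ?_⟩ k
    rintro _ ⟨i, rfl⟩
    exact mul_le_mul (hwS i) (Real.Angle.dist_le_pi _ _) dist_nonneg hS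
  have hD0 : ∀ φ ψ, 0 ≤ D φ ψ := fun φ ψ =>
    Real.iSup_nonneg fun k => mul_nonneg (hw0 k) dist_nonneg
  have hsep : ∀ j k, j ≠ k → Ep j + η j k ≤ Em k ∨ Ep k + η j k ≤ Em j := fun j k hjk => by
    rcases hηdist j k hjk with h | h
    · left; linarith [h.2]
    · right; linarith [h.2]
  have hs : ∀ j, Summable fun l : {l : J // l ≠ j} => (Ep l.1 - Em l.1) / η j l.1 := fun j => by
    refine Summable.of_nonneg_of_le (fun l => ?_) (fun l => ?_)
      ((hC2sum j).mul_left ((∑' j, w j) / √(Ep j - Em j)))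
    · exact div_nonneg (hγ _).le (hηpos _ _ l.2.symm).le
    · have h1 := Real.sqrt_pos.2 (hγ j)
      have h2 := hηpos _ _ l.2.symm
      have h3 : √(Ep l.1 - Em l.1) ≤ ∑' j, w j :=
        (Real.sqrt_le_sqrt (le_mul_of_one_le_right (hγ _).le (hN _))).trans (hwS l.1)
      calc (Ep l.1 - Em l.1) / η j l.1 = √(Ep l.1 - Em l.1) * √(Ep l.1 - Em l.1) / η j l.1 := by
            rw [Real.mul_self_sqrt (hγ _).le]
        _ ≤ (∑' j, w j) * √(Ep l.1 - Em l.1) / η j l.1 := by gcongr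
        _ = _ := by field_simp
  obtain ⟨M, hM, hP⟩ : IsBoundedLip D N fun φ j => ∑ l ∈ Finset.range (n + 1),
      Rfield Ebot Em Ep (n - l) φ * gapMu Em Ep φ j ^ l :=
    .sum hD0 hN fun l hl => (isBoundedLip_Rfield hD0 fun k hk =>
      isBoundedLip_Qfield hlt hη0pos hC1 hD0 hD (hk.trans (Nat.sub_le n l))).mul
      (isBoundedLip_gapMu_pow hlt hη0pos hS hwS hD (Finset.mem_range_succ_iff.1 hl))
  refine ⟨2 * M * (K₄ + K₃ / 4 + K₂), fun φ ψ j => ?_⟩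
  have hexp : ∀ φ, Real.exp (logPsi Ebot Em Ep φ j) ≤ C j := fun φ => by
    rw [hC]
    exact exp_logPsi_le hlt hηpos hsep hη0pos (hs j) φ
  have hCj : 0 ≤ C j := (Real.exp_pos _).le.trans (hexp φ)
  have hNj : 0 < N j := by linarith [hN j]
  have hΨ := Psifield_eq_two_mul_exp hlt hηpos hsep hη0pos (hs j)
  have hlog := mul_abs_logPsi_sub_logPsi_le hlt hηpos hsep hη0pos hN (hs j) (hC2sum j) (hD φ ψ)
  have hexp' := abs_exp_sub_exp_le (hexp φ) (hexp ψ)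
  obtain ⟨-, hPsub⟩ := hP φ ψ j
  obtain ⟨hPle, -⟩ := hP ψ φ j
  specialize hK₂ j
  specialize hK₃ j
  specialize hK₄ j
  change C j * N j ^ ((3 : ℝ) / 2) * _ ≤ K₂ at hK₂
  change _ * N j * _ / _ ≤ K₃ at hK₃
  change _ * N j ^ ((3 : ℝ) / 2) ≤ K₄ at hK₄
  rw [Real.rpow_three_halves hNj] at hK₂ hK₄
  have hwj : w j = √(Ep j - Em j) * √(N j) := Real.sqrt_mul (hγ j).le _
  unfold Xifield
  rw [hΨ φ, hΨ ψ]
  change w j * _ ≤ _ * D φ ψ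
  set P := ∑ l ∈ Finset.range (n + 1), Rfield Ebot Em Ep (n - l) φ * gapMu Em Ep φ j ^ l
  set P' := ∑ l ∈ Finset.range (n + 1), Rfield Ebot Em Ep (n - l) ψ * gapMu Em Ep ψ j ^ l
  set g := logPsi Ebot Em Ep φ j
  set g' := logPsi Ebot Em Ep ψ j
  set A := ∑' l : {l : J // l ≠ j}, √(Ep l.1 - Em l.1) * √(Ep j - Em j) / η j l.1
  have hwj0 := hw0 j
  have hD' := hD0 φ ψ
  calc w j * |P * (2 * Real.exp g) - P' * (2 * Real.exp g')|
      = w j * |2 * ((P - P') * Real.exp g + P' * (Real.exp g - Real.exp g'))| := by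
        congr 2
        ring
    _ ≤ w j * (2 * (|P - P'| * Real.exp g + |P'| * |Real.exp g - Real.exp g'|)) := by
        rw [abs_mul 2, abs_two]
        gcongr
        refine (abs_add_le _ _).trans_eq ?_
        rw [abs_mul, abs_mul, Real.abs_exp]
    _ ≤ w j * (2 * (M * N j * D φ ψ * C j + M * N j * (C j * |g - g'|))) := by
        gcongr
        exact hexp φ
    _ = 2 * M * (C j * N j * w j) * D φ ψ + 2 * M * (C j * N j) * (w j * |g - g'|) := by ring
    _ ≤ 2 * M * (C j * N j * w j) * D φ ψ + 2 * M * (C j * N j) *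
          (((Ep j - Em j) / (4 * (Em j - Ebot)) + √(N j) * A) * D φ ψ) := by gcongr
    _ = 2 * M * (C j * √(Ep j - Em j) * (N j * √(N j)) +
          (Ep j - Em j) * N j * C j / (Em j - Ebot) / 4 +
          C j * (N j * √(N j)) * A) * D φ ψ := by
        rw [hwj]
        field_simp
        ring
    _ ≤ _ := by gcongr
end

section
/- Let E̲ ∈ ℝ, n a positive integer, and ε ∈ (0, π/2). Then for all ξ ∈ ℝ with ξ ≥ E̲ and all z ∈ ℂ with z ≠ 0 and arg(z − E̲) ∈ (ε, 2π − ε) (in particular z ∉ [E̲, ∞)), one has | 1/(ξ − z) + Σ_{k=1}^n ξ^{k−1}/z^k | ≤ (1 + 1/sin ε) · |ξ|^n / (|z|^n |z − E̲|). -/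
open Real

theorem inv_sub_add_sum_pow_div_pow {K : Type*} [Field K] {x z : K} (hz : z ≠ 0) (hxz : x - z ≠ 0)
    (n : ℕ) :
    1 / (x - z) + ∑ k ∈ Finset.Icc 1 n, x ^ (k - 1) / z ^ k = x ^ n / z ^ n / (x - z) := by
  induction n with
  | zero => simp
  | succ n ih =>
    rw [Finset.sum_Icc_succ_top (by lia), ← add_assoc, ih, Nat.add_sub_cancel]
    field_simp
    ring

theorem sin_mul_norm_le_norm_ofReal_sub {w : ℂ} {t ε : ℝ} (ht : 0 ≤ t) (hε : 0 ≤ ε)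
    (hw : ε ≤ |w.arg|) : Real.sin ε * ‖w‖ ≤ ‖(t : ℂ) - w‖ := by
  have hcos : Real.cos w.arg ≤ Real.cos ε := by
    rw [← Real.cos_abs w.arg]
    exact Real.cos_le_cos_of_nonneg_of_le_pi hε (Complex.abs_arg_le_pi w) hw
  have hre : w.re ≤ ‖w‖ * Real.cos ε := by
    rw [← Complex.norm_mul_cos_arg w]
    gcongr
  refine le_of_pow_le_pow_left₀ two_ne_zero (norm_nonneg _) ?_
  have hnorm : ‖(t : ℂ) - w‖ ^ 2 = t ^ 2 - 2 * (t * w.re) + ‖w‖ ^ 2 := by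
    simp only [Complex.sq_norm, Complex.normSq_apply, Complex.sub_re, Complex.sub_im,
      Complex.ofReal_re, Complex.ofReal_im]
    ring
  rw [hnorm, mul_pow, Real.sin_sq]
  nlinarith [mul_le_mul_of_nonneg_left hre ht, sq_nonneg (t - ‖w‖ * Real.cos ε)]

/-- Sector estimate: for `ξ ≥ E̲` and `z` off the halfline `[E̲,∞)`, at angle more than `ε`
from it (the branch of `arg` with values in `(0,2π)` lies in `(ε, 2π − ε)`, which is
equivalent to `ε < |Complex.arg (z − E̲)|` for the principal branch),
`|1/(ξ−z) + Σ_{k=1}^n ξ^{k−1}/z^k| ≤ (1 + 1/sin ε) |ξ|^n / (|z|^n |z−E̲|)`. -/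
theorem sector_resolvent_expansion_estimate (Ebot : ℝ) (n : ℕ) (hn : 1 ≤ n)
    (ε : ℝ) (hε : 0 < ε) (hε' : ε < π / 2)
    (ξ : ℝ) (hξ : Ebot ≤ ξ) (z : ℂ) (hz : z ≠ 0)
    (harg : ε < |Complex.arg (z - (Ebot : ℂ))|) :
    ‖1 / ((ξ : ℂ) - z) + ∑ k ∈ Finset.Icc 1 n, (ξ : ℂ) ^ (k - 1) / z ^ k‖ ≤
      (1 + 1 / Real.sin ε) * |ξ| ^ n / (‖z‖ ^ n * ‖z - (Ebot : ℂ)‖) := by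
  have hsin : 0 < Real.sin ε := Real.sin_pos_of_pos_of_lt_pi hε (by linarith)
  have hw : 0 < ‖z - (Ebot : ℂ)‖ := by
    rw [norm_pos_iff]
    intro h
    rw [h, Complex.arg_zero, abs_zero] at harg
    exact hε.not_gt harg
  have hlow : Real.sin ε * ‖z - (Ebot : ℂ)‖ ≤ ‖(ξ : ℂ) - z‖ := by
    have h := sin_mul_norm_le_norm_ofReal_sub (sub_nonneg.2 hξ) hε.le harg.le
    rwa [Complex.ofReal_sub, sub_sub_sub_cancel_right] at h
  have hpos : 0 < Real.sin ε * ‖z - (Ebot : ℂ)‖ := mul_pos hsin hw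
  have hzn : 0 < ‖z‖ := norm_pos_iff.2 hz
  rw [inv_sub_add_sum_pow_div_pow hz (norm_pos_iff.1 (hpos.trans_le hlow)), norm_div, norm_div,
    norm_pow, norm_pow, Complex.norm_real, Real.norm_eq_abs]
  calc |ξ| ^ n / ‖z‖ ^ n / ‖(ξ : ℂ) - z‖
      ≤ |ξ| ^ n / ‖z‖ ^ n / (Real.sin ε * ‖z - (Ebot : ℂ)‖) := by gcongr
    _ = 1 / Real.sin ε * |ξ| ^ n / (‖z‖ ^ n * ‖z - (Ebot : ℂ)‖) := by field_simp
    _ ≤ (1 + 1 / Real.sin ε) * |ξ| ^ n / (‖z‖ ^ n * ‖z - (Ebot : ℂ)‖) := by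
      gcongr
      linarith
end

section
/- Let E̲ ∈ ℝ, let J be a countable index set with gaps (E_j^-, E_j^+), j ∈ J, pairwise disjoint, E̲ ≤ E_j^-, fix a positive integer n with Σ_{j∈J} γ_j (1 + η_{j,0}^n) < ∞, let μ_j ∈ [E_j^-, E_j^+] for each j, and define f : [E̲, ∞) → ℝ by f(ξ) = −1/2 for ξ ∈ (E_j^-, μ_j), f(ξ) = 1/2 for ξ ∈ (μ_j, E_j^+) (for each j ∈ J), and f(ξ) = 0 otherwise. Then for every integer k with 1 ≤ k ≤ n+1, the function ξ ↦ ξ^{k−1} f(ξ) is Lebesgue integrable on [E̲, ∞) and 2k ∫_{E̲}^∞ ξ^{k−1} f(ξ) dξ = Q_k − E̲^k, where Q_k = E̲^k + Σ_{j∈J} ((E_j^-)^k + (E_j^+)^k − 2 μ_j^k). -/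
open MeasureTheory

section PhaseFunction

variable {a b m : ℝ} {f : ℝ → ℝ}

/-- If `f` is constant on an open interval, then `ξ ^ p * f ξ` is integrable there whatever the
values of `f` at the endpoints. -/
lemma intervalIntegrable_pow_mul_of_eqOn_const (hab : a ≤ b) {c : ℝ}
    (hf : ∀ ξ ∈ Set.Ioo a b, f ξ = c) (p : ℕ) :
    IntervalIntegrable (fun ξ => ξ ^ p * f ξ) volume a b := by
  have hc : IntervalIntegrable (fun ξ : ℝ => ξ ^ p * c) volume a b :=
    Continuous.intervalIntegrable (by fun_prop) _ _
  rw [intervalIntegrable_iff_integrableOn_Ioo_of_le hab] at hc ⊢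
  exact hc.congr_fun (fun ξ hξ => by simp only [hf ξ hξ]) measurableSet_Ioo

lemma integral_pow_mul_of_eqOn_const (hab : a ≤ b) {c : ℝ}
    (hf : ∀ ξ ∈ Set.Ioo a b, f ξ = c) (p : ℕ) :
    ∫ ξ in a..b, ξ ^ p * f ξ = (b ^ (p + 1) - a ^ (p + 1)) / (p + 1) * c := by
  rw [← integral_pow, ← intervalIntegral.integral_mul_const,
    intervalIntegral.integral_of_le hab, intervalIntegral.integral_of_le hab,
    integral_Ioc_eq_integral_Ioo, integral_Ioc_eq_integral_Ioo]
  exact setIntegral_congr_fun measurableSet_Ioo fun ξ hξ => by simp only [hf ξ hξ]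

lemma integrableOn_pow_mul_of_step (hm : m ∈ Set.Icc a b)
    (hf1 : ∀ ξ ∈ Set.Ioo a m, f ξ = -(1 / 2)) (hf2 : ∀ ξ ∈ Set.Ioo m b, f ξ = 1 / 2) (p : ℕ) :
    IntegrableOn (fun ξ => ξ ^ p * f ξ) (Set.Ioo a b) :=
  (intervalIntegrable_iff_integrableOn_Ioo_of_le (hm.1.trans hm.2)).1 <|
    (intervalIntegrable_pow_mul_of_eqOn_const hm.1 hf1 p).trans
      (intervalIntegrable_pow_mul_of_eqOn_const hm.2 hf2 p)

lemma integral_pow_mul_of_step (hm : m ∈ Set.Icc a b)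
    (hf1 : ∀ ξ ∈ Set.Ioo a m, f ξ = -(1 / 2)) (hf2 : ∀ ξ ∈ Set.Ioo m b, f ξ = 1 / 2) (p : ℕ) :
    2 * ((p + 1 : ℕ) : ℝ) * ∫ ξ in Set.Ioo a b, ξ ^ p * f ξ =
      a ^ (p + 1) + b ^ (p + 1) - 2 * m ^ (p + 1) := by
  rw [← integral_Ioc_eq_integral_Ioo, ← intervalIntegral.integral_of_le (hm.1.trans hm.2),
    ← intervalIntegral.integral_add_adjacent_intervals
      (intervalIntegrable_pow_mul_of_eqOn_const hm.1 hf1 p)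
      (intervalIntegrable_pow_mul_of_eqOn_const hm.2 hf2 p),
    integral_pow_mul_of_eqOn_const hm.1 hf1, integral_pow_mul_of_eqOn_const hm.2 hf2]
  have : (p : ℝ) + 1 ≠ 0 := by positivity
  push_cast
  field_simp
  ring

/-- Polynomial growth bound with a constant uniform in `t`. -/
lemma pow_le_mul_one_add_pow {x t B : ℝ} {p n : ℕ} (hx : 0 ≤ x) (ht : 0 ≤ t) (hB : 1 ≤ B)
    (hxt : x ≤ B + t) (hp : p ≤ n) :
    x ^ p ≤ B ^ n * 2 ^ (n - 1) * (1 + t ^ n) := by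
  calc x ^ p ≤ (B * (1 + t)) ^ p := by
        gcongr
        nlinarith
    _ ≤ (B * (1 + t)) ^ n := pow_le_pow_right₀ (by nlinarith) hp
    _ = B ^ n * (1 + t) ^ n := mul_pow _ _ _
    _ ≤ B ^ n * (2 ^ (n - 1) * (1 ^ n + t ^ n)) := by
        gcongr
        exact add_pow_le zero_le_one ht n
    _ = _ := by rw [one_pow]; ring

end PhaseFunction

/-- Moment identity for the phase function `f` of the exponential Herglotz representation:
for `1 ≤ k ≤ n+1`, `ξ^{k−1} f(ξ)` is integrable on `[E̲,∞)` and
`2k ∫ ξ^{k−1} f(ξ) dξ = Q_k − E̲^k = Σ_j ((E_j^-)^k + (E_j^+)^k − 2μ_j^k)`. -/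
theorem phase_function_moments {J : Type*} [Countable J] (Ebot : ℝ) (Em Ep : J → ℝ)
    (hlt : ∀ j, Em j < Ep j) (hbot : ∀ j, Ebot ≤ Em j)
    (hdisj : ∀ i j, i ≠ j → Disjoint (Set.Ioo (Em i) (Ep i)) (Set.Ioo (Em j) (Ep j)))
    (n : ℕ) (hn : 1 ≤ n)
    (hmom : Summable fun j => (Ep j - Em j) * (1 + (Em j - Ebot) ^ n))
    (μ : J → ℝ) (hμ : ∀ j, μ j ∈ Set.Icc (Em j) (Ep j))
    (f : ℝ → ℝ)
    (hf1 : ∀ j, ∀ ξ ∈ Set.Ioo (Em j) (μ j), f ξ = -(1 / 2))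
    (hf2 : ∀ j, ∀ ξ ∈ Set.Ioo (μ j) (Ep j), f ξ = 1 / 2)
    (hf0 : ∀ ξ : ℝ, (∀ j, ξ ∉ Set.Ioo (Em j) (μ j) ∪ Set.Ioo (μ j) (Ep j)) → f ξ = 0) :
    ∀ k : ℕ, 1 ≤ k → k ≤ n + 1 →
      IntegrableOn (fun ξ => ξ ^ (k - 1) * f ξ) (Set.Ici Ebot) ∧
      2 * (k : ℝ) * ∫ ξ in Set.Ici Ebot, ξ ^ (k - 1) * f ξ =
        ∑' j, (Em j ^ k + Ep j ^ k - 2 * μ j ^ k) := by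
  intro k hk hkn
  obtain ⟨p, rfl⟩ : ∃ p, k = p + 1 := ⟨k - 1, by omega⟩
  simp only [Nat.add_sub_cancel]
  have hη : ∀ j, 0 ≤ Em j - Ebot := fun j => sub_nonneg.2 (hbot j)
  have hγ : ∀ j, 0 < Ep j - Em j := fun j => sub_pos.2 (hlt j)
  have hbound : ∀ ξ, |f ξ| ≤ 1 := by
    intro ξ
    by_cases h : ∀ j, ξ ∉ Set.Ioo (Em j) (μ j) ∪ Set.Ioo (μ j) (Ep j)
    · simp [hf0 ξ h]
    · push Not at h
      obtain ⟨j, h | h⟩ := h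
      · rw [hf1 j ξ h]; norm_num [abs_le]
      · rw [hf2 j ξ h]; norm_num [abs_le]
  have hzero : ∀ ξ, ξ ∉ ⋃ j, Set.Ioo (Em j) (Ep j) → f ξ = 0 := by
    refine fun ξ hξ => hf0 ξ fun j hj => hξ (Set.mem_iUnion.2 ⟨j, ?_⟩)
    rcases hj with h | h
    · exact ⟨h.1, h.2.trans_le (hμ j).2⟩
    · exact ⟨(hμ j).1.trans_lt h.1, h.2⟩
  have hsub : (⋃ j, Set.Ioo (Em j) (Ep j)) ⊆ Set.Ici Ebot :=
    Set.iUnion_subset fun j ξ hξ => (hbot j).trans hξ.1.le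
  set S := ∑' j, (Ep j - Em j) * (1 + (Em j - Ebot) ^ n) with hS
  have hterm : ∀ j, 0 ≤ (Ep j - Em j) * (1 + (Em j - Ebot) ^ n) := fun j =>
    mul_nonneg (hγ j).le (add_nonneg zero_le_one (pow_nonneg (hη j) n))
  have hS0 : 0 ≤ S := tsum_nonneg hterm
  have hγS : ∀ j, Ep j - Em j ≤ S := fun j =>
    (le_mul_of_one_le_right (hγ j).le (le_add_of_nonneg_right (pow_nonneg (hη j) n))).trans
      (hmom.le_tsum j fun i _ => hterm i)
  have hint : ∀ j, IntegrableOn (fun ξ => ξ ^ p * f ξ) (Set.Ioo (Em j) (Ep j)) := fun j =>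
    integrableOn_pow_mul_of_step (hμ j) (hf1 j) (hf2 j) p
  set C := (1 + |Ebot| + S) ^ n * 2 ^ (n - 1) with hC
  have hnorm : ∀ j, ∀ ξ ∈ Set.Ioo (Em j) (Ep j),
      ‖ξ ^ p * f ξ‖ ≤ C * (1 + (Em j - Ebot) ^ n) := by
    intro j ξ hξ
    rw [norm_mul, norm_pow, Real.norm_eq_abs, Real.norm_eq_abs]
    refine (mul_le_of_le_one_right (by positivity) (hbound ξ)).trans ?_
    refine pow_le_mul_one_add_pow (abs_nonneg _) (hη j)
      (by linarith [abs_nonneg Ebot]) ?_ (by omega)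
    have := hγS j
    have := hη j
    rw [abs_le]
    constructor <;> linarith [hξ.1, hξ.2, neg_abs_le Ebot, le_abs_self Ebot]
  have hsum : Summable fun j => ∫ ξ in Set.Ioo (Em j) (Ep j), ‖ξ ^ p * f ξ‖ := by
    refine Summable.of_nonneg_of_le (fun j => integral_nonneg fun _ => norm_nonneg _)
      (fun j => ?_) (hmom.mul_left C)
    calc ∫ ξ in Set.Ioo (Em j) (Ep j), ‖ξ ^ p * f ξ‖
        ≤ ∫ ξ in Set.Ioo (Em j) (Ep j), C * (1 + (Em j - Ebot) ^ n) :=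
          setIntegral_mono_on (hint j).norm (integrableOn_const (by simp)) measurableSet_Ioo
            (hnorm j)
      _ = C * ((Ep j - Em j) * (1 + (Em j - Ebot) ^ n)) := by
          rw [setIntegral_const, Real.volume_real_Ioo_of_le (hlt j).le, smul_eq_mul]
          ring
  have hU : IntegrableOn (fun ξ => ξ ^ p * f ξ) (⋃ j, Set.Ioo (Em j) (Ep j)) :=
    integrableOn_iUnion_of_summable_integral_norm hint hsum
  refine ⟨hU.of_forall_sdiff_eq_zero measurableSet_Ici fun ξ hξ => by simp [hzero ξ hξ.2], ?_⟩
  rw [setIntegral_eq_of_subset_of_forall_sdiff_eq_zero measurableSet_Ici hsub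
      fun ξ hξ => by simp [hzero ξ hξ.2],
    integral_iUnion (fun j => measurableSet_Ioo) (fun i j hij => hdisj i j hij) hU,
    ← tsum_mul_left]
  exact tsum_congr fun j => integral_pow_mul_of_step (hμ j) (hf1 j) (hf2 j) p
end

section
/- Let ν be a positive integer, fix a norm |·| on ℤ^ν, and let ε, κ₀, a, b be positive reals. Let (γ_k)_{k ∈ ℤ^ν \ {0}} be positive reals with γ_k < 2ε exp(−κ₀|k|/2) for all k, and let (η_{m,k}) be positive reals indexed by pairs of distinct m, k ∈ ℤ^ν \ {0} with η_{m,k} ≥ a·max(|m|,|k|)^{−b}. Then for every m ∈ ℤ^ν \ {0}, Σ_{k ≠ m} γ_k^{1/2}/η_{m,k} ≤ (√(2ε)/a) · ( Σ_{k ∈ ℤ^ν \ {0}} |k|^b exp(−κ₀|k|/4) ) · (1 + |m|^b), and in particular the series on the left converges and the series Σ_{k ∈ ℤ^ν \ {0}} |k|^b exp(−κ₀|k|/4) is finite. -/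
open scoped BigOperators

/-- `∑ ‖k‖ ^ r` over the integer vectors converges for some real exponent `r`. -/
lemma exists_summable_norm_rpow_int (n : ℕ) :
    ∃ r : ℝ, Summable fun k : Fin n → ℤ => ‖k‖ ^ r := by
  let B := Pi.basisFun ℝ (Fin n)
  let L : Submodule ℤ (Fin n → ℝ) := Submodule.span ℤ (Set.range B)
  have hmem : ∀ k : Fin n → ℤ, (fun i => (k i : ℝ)) ∈ L := fun k =>
    (B.mem_span_iff_repr_mem ℤ _).2 fun i => ⟨k i, by simp [B]⟩
  refine ⟨-Module.finrank ℤ L - 1, ?_⟩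
  have hs := ZLattice.summable_norm_rpow L (-Module.finrank ℤ L - 1) (by linarith)
  have hinj : Function.Injective fun k : Fin n → ℤ => (⟨_, hmem k⟩ : L) := by
    intro k l h
    funext i
    exact Int.cast_injective (α := ℝ) (congrFun (congrArg Subtype.val h) i)
  refine (hs.comp_injective hinj).congr fun k => ?_
  have hnorm : ‖(⟨_, hmem k⟩ : L)‖ = ‖k‖ := by
    simp [Pi.norm_def, nnnorm, Int.norm_eq_abs]
  simp only [Function.comp_apply, hnorm]

lemma summable_norm_rpow_mul_exp_int (n : ℕ) (b : ℝ) {c : ℝ} (hc : 0 < c) :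
    Summable fun k : Fin n → ℤ => ‖k‖ ^ b * Real.exp (-c * ‖k‖) := by
  obtain ⟨r, hr⟩ := exists_summable_norm_rpow_int n
  have htend : Filter.Tendsto (fun k : Fin n → ℤ => ‖k‖) Filter.cofinite Filter.atTop := by
    rw [← Filter.cocompact_eq_cofinite]
    exact tendsto_norm_cocompact_atTop
  refine summable_of_isBigO hr ?_
  have h : (fun x : ℝ => x ^ b * Real.exp (-c * x)) =O[Filter.atTop] fun x : ℝ => x ^ r := by
    refine ((Asymptotics.isBigO_refl (fun x : ℝ => x ^ b) Filter.atTop).mul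
      (isLittleO_exp_neg_mul_rpow_atTop hc (r - b)).isBigO).congr' .rfl ?_
    filter_upwards [Filter.eventually_gt_atTop 0] with x hx
    rw [← Real.rpow_add hx, add_sub_cancel]
  exact h.comp_tendsto htend

lemma one_le_norm_of_ne_zero_int {n : ℕ} {k : Fin n → ℤ} (hk : k ≠ 0) : 1 ≤ ‖k‖ := by
  obtain ⟨i, hi⟩ := Function.ne_iff.1 hk
  refine le_trans ?_ (norm_le_pi_norm k i)
  rw [Int.norm_eq_abs]
  exact_mod_cast Int.one_le_abs hi

lemma max_rpow_le_rpow_mul_one_add_rpow {x y b : ℝ} (hx : 1 ≤ x) (hy : 1 ≤ y) (hb : 0 ≤ b) :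
    max x y ^ b ≤ y ^ b * (1 + x ^ b) := by
  have hxb := Real.one_le_rpow hx hb
  have hyb := Real.one_le_rpow hy hb
  rcases max_choice x y with h | h <;> rw [h] <;> nlinarith

lemma sqrt_div_le_of_le_exp {g e ε κ a b x y : ℝ} (hε : 0 < ε) (ha : 0 < a) (hb : 0 ≤ b)
    (hx : 1 ≤ x) (hy : 1 ≤ y) (hg : g ≤ 2 * ε * Real.exp (-(κ * y) / 2))
    (he : a * max x y ^ (-b) ≤ e) :
    √g / e ≤ √(2 * ε) / a * (y ^ b * Real.exp (-(κ * y) / 4)) * (1 + x ^ b) := by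
  have hmax : 0 < max x y := by positivity
  have hsqrt : √g ≤ √(2 * ε) * Real.exp (-(κ * y) / 4) := by
    refine (Real.sqrt_le_sqrt hg).trans_eq ?_
    rw [Real.sqrt_mul (by positivity), ← Real.exp_half]
    ring_nf
  calc √g / e ≤ √(2 * ε) * Real.exp (-(κ * y) / 4) / (a * max x y ^ (-b)) := by
        gcongr
    _ = √(2 * ε) / a * Real.exp (-(κ * y) / 4) * max x y ^ b := by
        rw [Real.rpow_neg hmax.le]
        field_simp
    _ ≤ √(2 * ε) / a * Real.exp (-(κ * y) / 4) * (y ^ b * (1 + x ^ b)) := by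
        gcongr
        exact max_rpow_le_rpow_mul_one_add_rpow hx hy hb
    _ = _ := by ring

/-- Inner estimate in the proof of Lemma 5.1: with exponentially small gap lengths and
polynomially lower-bounded gap distances,
`Σ_{k≠m} γ_k^{1/2}/η_{m,k} ≤ (√(2ε)/a)(Σ_{k≠0} |k|^b e^{−κ₀|k|/4})(1 + |m|^b)`,
and in particular both series converge. -/
theorem quasiperiodic_inner_gap_sum_estimate (ν : ℕ) (hν : 0 < ν)
    (ε κ₀ a b : ℝ) (hε : 0 < ε) (hκ : 0 < κ₀) (ha : 0 < a) (hb : 0 < b)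
    (γ : (Fin ν → ℤ) → ℝ) (η : (Fin ν → ℤ) → (Fin ν → ℤ) → ℝ)
    (hγpos : ∀ k : Fin ν → ℤ, k ≠ 0 → 0 < γ k)
    (hγ : ∀ k : Fin ν → ℤ, k ≠ 0 → γ k < 2 * ε * Real.exp (-(κ₀ * ‖k‖) / 2))
    (hηpos : ∀ m k : Fin ν → ℤ, m ≠ 0 → k ≠ 0 → m ≠ k → 0 < η m k)
    (hη : ∀ m k : Fin ν → ℤ, m ≠ 0 → k ≠ 0 → m ≠ k →
      a * max ‖m‖ ‖k‖ ^ (-b) ≤ η m k) :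
    (Summable fun k : {k : Fin ν → ℤ // k ≠ 0} =>
      ‖k.1‖ ^ b * Real.exp (-(κ₀ * ‖k.1‖) / 4)) ∧
    ∀ m : Fin ν → ℤ, m ≠ 0 →
      (Summable fun k : {k : Fin ν → ℤ // k ≠ 0 ∧ k ≠ m} =>
        Real.sqrt (γ k.1) / η m k.1) ∧
      (∑' k : {k : Fin ν → ℤ // k ≠ 0 ∧ k ≠ m}, Real.sqrt (γ k.1) / η m k.1) ≤
        (Real.sqrt (2 * ε) / a) *
          (∑' k : {k : Fin ν → ℤ // k ≠ 0}, ‖k.1‖ ^ b * Real.exp (-(κ₀ * ‖k.1‖) / 4)) *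
          (1 + ‖m‖ ^ b) := by
  have hsum : Summable fun k : {k : Fin ν → ℤ // k ≠ 0} =>
      ‖k.1‖ ^ b * Real.exp (-(κ₀ * ‖k.1‖) / 4) := by
    refine ((summable_norm_rpow_mul_exp_int ν b (c := κ₀ / 4) (by positivity)).comp_injective
      Subtype.val_injective).congr fun k => ?_
    simp only [Function.comp_apply]
    ring_nf
  refine ⟨hsum, fun m hm => ?_⟩
  let i : {k : Fin ν → ℤ // k ≠ 0 ∧ k ≠ m} → {k : Fin ν → ℤ // k ≠ 0} := fun k => ⟨k.1, k.2.1⟩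
  have hi : Function.Injective i := fun k l h => by
    simpa only [i, Subtype.ext_iff] using h
  have hmaj := (hsum.mul_left (√(2 * ε) / a)).mul_right (1 + ‖m‖ ^ b)
  have hle : ∀ k : {k : Fin ν → ℤ // k ≠ 0 ∧ k ≠ m}, √(γ k.1) / η m k.1 ≤
      √(2 * ε) / a * (‖(i k).1‖ ^ b * Real.exp (-(κ₀ * ‖(i k).1‖) / 4)) * (1 + ‖m‖ ^ b) :=
    fun k => sqrt_div_le_of_le_exp hε ha hb.le (one_le_norm_of_ne_zero_int hm)
      (one_le_norm_of_ne_zero_int k.2.1) (hγ k.1 k.2.1).le (hη m k.1 hm k.2.1 k.2.2.symm)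
  have hsum' : Summable fun k : {k : Fin ν → ℤ // k ≠ 0 ∧ k ≠ m} => √(γ k.1) / η m k.1 :=
    .of_nonneg_of_le
      (fun k => div_nonneg (Real.sqrt_nonneg _) (hηpos m k.1 hm k.2.1 k.2.2.symm).le)
      hle (hmaj.comp_injective hi)
  refine ⟨hsum', ?_⟩
  rw [← tsum_mul_left, ← tsum_mul_right]
  exact hsum'.tsum_le_tsum_of_inj i hi (fun k _ => by positivity) hle hmaj
end
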